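/- Let S be a cyclically reduced X-digraph satisfying Property (L) with distinguished letter v and unique v-edge e, and let φ = (C, m) be a reducing type II Whitehead automorphism for S with m ∉ {v, v⁻¹}. Then φ(S) also has a unique v-edge, and this edge is a cut edge of φ(S); moreover φ(S) satisfies Property (L). -/

import Mathlib

/-- An `X`-digraph: a finite directed graph with edges labeled by elements of `X`. -/
structure XDigraph (X : Type) where
  V : Type
  E : Type
  [fintypeV : Fintype V]
  [fintypeE : Fintype E]
  [decV : DecidableEq V]
  [decE : DecidableEq E]
  init : E → V
  term : E → V
  lab : E → X

attribute [instance] XDigraph.fintypeV XDigraph.fintypeE XDigraph.decV XDigraph.decE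

namespace XDigraph

variable {X : Type} (S : XDigraph X)

/-- A dart is an edge together with a direction (`true` = forward). -/
abbrev Dart := S.E × Bool

def dInit (d : S.Dart) : S.V := if d.2 then S.init d.1 else S.term d.1

def dTerm (d : S.Dart) : S.V := if d.2 then S.term d.1 else S.init d.1

/-- The label of a dart, as an element of `X ∪ X⁻¹` (encoded as `X × Bool`). -/
def dLab (d : S.Dart) : X × Bool := (S.lab d.1, d.2)

def dRev (d : S.Dart) : S.Dart := (d.1, !d.2)

/-- The degree of a vertex: the number of darts pointing into it. -/
def degree (v : S.V) : ℕ := (Finset.univ.filter (fun d : S.Dart => S.dTerm d = v)).card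

/-- The hyperlink of a vertex: the set of labels of darts pointing into it. -/
def hyperlink (v : S.V) : Set (X × Bool) := {p | ∃ d : S.Dart, S.dTerm d = v ∧ S.dLab d = p}

/-- `S` is folded if darts into the same vertex have distinct labels. -/
def Folded : Prop := ∀ v : S.V, Set.InjOn S.dLab {d : S.Dart | S.dTerm d = v}

def Adj (u v : S.V) : Prop := ∃ d : S.Dart, S.dInit d = u ∧ S.dTerm d = v

def Connected : Prop := Nonempty S.V ∧ ∀ u v : S.V, Relation.EqvGen S.Adj u v

/-- A cyclically reduced graph has no leaves (vertices of degree one). -/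
def NoLeaf : Prop := ∀ v : S.V, S.degree v ≠ 1

def IsPath (p : List S.Dart) : Prop := p.Chain' (fun d d' => S.dTerm d = S.dInit d')

/-- A path is immersed if no dart is immediately followed by its reverse. -/
def Immersed (p : List S.Dart) : Prop := p.Chain' (fun d d' => d' ≠ S.dRev d)

def IsLoopAt (p : List S.Dart) (v : S.V) : Prop :=
  S.IsPath p ∧ ∀ h : p ≠ [], S.dInit (p.head h) = v ∧ S.dTerm (p.getLast h) = v

def pathLab (p : List S.Dart) : List (X × Bool) := p.map S.dLab

/-- Adjacency using only edges satisfying `P`. -/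
def AdjOn (P : S.E → Prop) (u v : S.V) : Prop :=
  ∃ e : S.E, P e ∧ ((S.init e = u ∧ S.term e = v) ∨ (S.init e = v ∧ S.term e = u))

end XDigraph

section Defs

variable {X : Type} [DecidableEq X]

/-- A list of letters in `X ∪ X⁻¹` is freely reduced: no `x x⁻¹` or `x⁻¹ x` subword. -/
def ReducedList (l : List (X × Bool)) : Prop :=
  List.Chain' (fun p q : X × Bool => p.1 ≠ q.1 ∨ p.2 = q.2) l

/-- `w` is cyclically reduced: every cyclic permutation of its reduced word is freely reduced. -/
def CyclRed (w : FreeGroup X) : Prop :=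
  ∀ l : List (X × Bool), w.toWord.IsRotated l → ReducedList l

/-- `w` is readable as the label of an immersed loop of `S` based at `v`. -/
def Reads (S : XDigraph X) (v : S.V) (w : FreeGroup X) : Prop :=
  ∃ p : List S.Dart, S.Immersed p ∧ S.IsLoopAt p v ∧ S.pathLab p = w.toWord

/-- `S`, with basepoint `base`, is the Stallings graph of the subgroup `H`:
a folded connected core graph whose immersed loops at `base` read exactly the elements of `H`. -/
def PRep (S : XDigraph X) (base : S.V) (H : Subgroup (FreeGroup X)) : Prop :=
  S.Folded ∧ S.Connected ∧ (∀ v : S.V, v ≠ base → 2 ≤ S.degree v) ∧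
    ∀ w : FreeGroup X, w ∈ H ↔ Reads S base w

/-- `S` is the cyclically reduced Stallings graph representing the conjugacy class of `H`:
a folded, connected, cyclically reduced graph whose immersed loops read exactly the
cyclically reduced elements of `F(X)` that are conjugate into `H`. -/
def CRep (S : XDigraph X) (H : Subgroup (FreeGroup X)) : Prop :=
  S.Folded ∧ S.Connected ∧ S.NoLeaf ∧
    ∀ w : FreeGroup X, CyclRed w →
      ((∃ v : S.V, Reads S v w) ↔ ∃ c : FreeGroup X, c * w * c⁻¹ ∈ H)

/-- The element of `F(X)` given by a single letter of `X ∪ X⁻¹`. -/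
def iota (p : X × Bool) : FreeGroup X :=
  if p.2 then FreeGroup.of p.1 else (FreeGroup.of p.1)⁻¹

/-- `φ` is the type II Whitehead automorphism with cut `C` and multiplier `m`. -/
def IsWhiteheadII (φ : FreeGroup X ≃* FreeGroup X) (C : Finset (X × Bool)) (m : X × Bool) :
    Prop :=
  m ∈ C ∧ (m.1, !m.2) ∉ C ∧
    ∀ x : X, φ (FreeGroup.of x) =
      if x = m.1 then FreeGroup.of x
      else (if (x, false) ∈ C then (iota m)⁻¹ else 1) * FreeGroup.of x *
           (if (x, true) ∈ C then iota m else 1)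

/-- The number of edges of `S` labeled `x`. -/
def edgeCount (S : XDigraph X) (x : X) : ℕ :=
  (Finset.univ.filter (fun e : S.E => S.lab e = x)).card

/-- The hyperlink of a vertex, as a finset. -/
def hyperlinkF (S : XDigraph X) (v : S.V) : Finset (X × Bool) :=
  (Finset.univ.filter (fun d : S.Dart => S.dTerm d = v)).image S.dLab

/-- The capacity of the cut `C` in the Whitehead hypergraph of `S`: the number of vertices
whose hyperlink meets both `C` and its complement. -/
def cap (S : XDigraph X) (C : Finset (X × Bool)) : ℕ :=
  (Finset.univ.filter
    (fun v : S.V => (hyperlinkF S v ∩ C).Nonempty ∧ (hyperlinkF S v \ C).Nonempty)).card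

/-- The degree of the letter `m` in the Whitehead hypergraph of `S`: the number of vertices
whose hyperlink contains `m`. -/
def wdeg (S : XDigraph X) (m : X × Bool) : ℕ :=
  (Finset.univ.filter (fun v : S.V => m ∈ hyperlinkF S v)).card

/-- The number of connected components of the subgraph of `S` spanned by the edges
satisfying `P`, on the vertex set `{v | W v}`. -/
noncomputable def componentsCount (S : XDigraph X) (P : S.E → Prop) (W : S.V → Prop) : ℕ :=
  Nat.card (Quotient (Setoid.comap (Subtype.val : {v : S.V // W v} → S.V)
    (Relation.EqvGen.setoid (S.AdjOn P))))

/-- The connected component of `u` in `S - e₀` has rank one (first Betti number one),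
i.e. it has as many edges as vertices. -/
def ComponentRankOne (S : XDigraph X) (e₀ : S.E) (u : S.V) : Prop :=
  Nat.card {e : S.E // e ≠ e₀ ∧ Relation.EqvGen (S.AdjOn (· ≠ e₀)) u (S.init e)} =
    Nat.card {v : S.V // Relation.EqvGen (S.AdjOn (· ≠ e₀)) u v}

/-- Property (L): `S` has a unique `v`-labeled edge `e₀`, and `S - e₀` has exactly two
connected components, at least one of which has rank one. -/
def PropertyL (S : XDigraph X) (v : X) : Prop :=
  ∃ e₀ : S.E, S.lab e₀ = v ∧ (∀ e : S.E, S.lab e = v → e = e₀) ∧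
    componentsCount S (· ≠ e₀) (fun _ => True) = 2 ∧
    ∃ u : S.V, ComponentRankOne S e₀ u

/-- Property (S) for the partition `X = A ⊔ Aᶜ`: `S` is connected and cyclically reduced,
the `A`-edges form a bouquet of single-edge loops at one vertex, and the subgraph spanned
by the remaining edges is connected of rank one. -/
def PropertyS (S : XDigraph X) (A : Set X) : Prop :=
  S.Connected ∧ S.NoLeaf ∧
    (∃ v₀ : S.V, ∀ e : S.E, S.lab e ∈ A → S.init e = v₀ ∧ S.term e = v₀) ∧
    Nat.card {e : S.E // S.lab e ∉ A} =
      Nat.card {w : S.V // ∃ e : S.E, S.lab e ∉ A ∧ (S.init e = w ∨ S.term e = w)} ∧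
    ∀ u w : S.V, (∃ e : S.E, S.lab e ∉ A ∧ (S.init e = u ∨ S.term e = u)) →
      (∃ e : S.E, S.lab e ∉ A ∧ (S.init e = w ∨ S.term e = w)) →
      Relation.EqvGen (S.AdjOn (fun e => S.lab e ∉ A)) u w

/-- An immersion of `X`-digraphs: a label- and orientation-preserving graph map which is
locally injective on links. -/
structure Immersion (S T : XDigraph X) where
  onV : S.V → T.V
  onE : S.E → T.E
  map_init : ∀ e : S.E, T.init (onE e) = onV (S.init e)
  map_term : ∀ e : S.E, T.term (onE e) = onV (S.term e)
  map_lab : ∀ e : S.E, T.lab (onE e) = S.lab e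
  locInj : ∀ (v : S.V) (d d' : S.Dart), S.dTerm d = v → S.dTerm d' = v →
    ((onE d.1, d.2) : T.Dart) = (onE d'.1, d'.2) → d = d'

/-- `K` is a proper free factor of `F(X)`: there is a nontrivial `L` with `F(X) = K ∗ L`. -/
def IsProperFreeFactor (K : Subgroup (FreeGroup X)) : Prop :=
  ∃ L : Subgroup (FreeGroup X), L ≠ ⊥ ∧
    Function.Bijective (Monoid.Coprod.lift K.subtype L.subtype)

end Defs

namespace FreeGroup

variable {α : Type*} {L L₁ L₂ : List (α × Bool)}

theorem IsReduced.isCyclicallyReduced_of_append_self (h : IsReduced (L ++ L)) :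
    IsCyclicallyReduced L := by
  rw [IsReduced, List.isChain_append] at h
  exact ⟨h.1, h.2.2⟩

theorem IsCyclicallyReduced.isRotated (h : IsCyclicallyReduced L₁) (hr : L₁ ~r L₂) :
    IsCyclicallyReduced L₂ := by
  obtain ⟨n, hn, rfl⟩ := List.isRotated_iff_mod.1 hr
  rw [List.rotate_eq_drop_append_take hn]
  apply IsReduced.isCyclicallyReduced_of_append_self
  have h3 := (h.flatten_replicate 3).isReduced
  refine h3.infix ⟨L₁.take n, L₁.drop n, ?_⟩
  simp only [List.replicate, List.flatten_cons, List.flatten_nil, List.append_nil]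
  conv_rhs => rw [← List.take_append_drop n L₁]
  simp only [List.append_assoc]

theorem IsReduced.invRev (h : IsReduced L) : IsReduced (invRev L) := by
  classical
  rw [isReduced_iff_reduce_eq] at h ⊢
  rw [reduce_invRev, h]

theorem IsReduced.mk_injective (h₁ : IsReduced L₁) (h₂ : IsReduced L₂) (h : mk L₁ = mk L₂) :
    L₁ = L₂ := by
  classical
  rw [← h₁.reduce_eq, ← h₂.reduce_eq, reduce.sound h]

theorem IsReduced.toWord_mk [DecidableEq α] (h : IsReduced L) : (mk L).toWord = L := by
  rw [FreeGroup.toWord_mk, h.reduce_eq]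

theorem isRotated_of_mk_conj {G : List (α × Bool)} (hG : IsReduced G)
    (h₁ : IsCyclicallyReduced L₁) (h₂ : IsCyclicallyReduced L₂)
    (h : mk L₂ = mk G * mk L₁ * (mk G)⁻¹) : L₁ ~r L₂ := by
  induction G using List.reverseRecOn generalizing L₁ with
  | nil =>
    rw [← one_eq_mk, one_mul, inv_one, mul_one] at h
    rw [h₂.isReduced.mk_injective h₁.isReduced h]
  | append_singleton G p ih =>
    have hG' : IsReduced G := hG.infix ⟨[], [p], by simp⟩
    rcases eq_or_ne L₁ [] with rfl | hne
    · rw [← one_eq_mk, mul_one, mul_inv_cancel, one_eq_mk] at h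
      rw [h₂.isReduced.mk_injective IsReduced.nil h]
    have hinv : (mk [p] : FreeGroup α)⁻¹ = mk [(p.1, !p.2)] := by simp [inv_mk, FreeGroup.invRev]
    rw [← mul_mk, mul_inv_rev] at h
    by_cases hd : L₁.head hne = (p.1, !p.2)
    · obtain ⟨M, rfl⟩ : ∃ M, L₁ = (p.1, !p.2) :: M := ⟨L₁.tail, by rw [← hd]; simp⟩
      have hr : (p.1, !p.2) :: M ~r M ++ [(p.1, !p.2)] := ⟨1, by simp⟩
      refine hr.trans (ih hG' (h₁.isRotated hr) ?_)
      have hM : (mk ((p.1, !p.2) :: M) : FreeGroup α) = (mk [p])⁻¹ * mk M := by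
        rw [hinv, mul_mk, List.singleton_append]
      rw [h, ← mul_mk, ← hinv, hM]
      group
    by_cases hl : L₁.getLast hne = p
    · obtain ⟨M, rfl⟩ : ∃ M, L₁ = M ++ [p] :=
        ⟨L₁.dropLast, by conv_rhs => rw [← hl, List.dropLast_append_getLast hne]⟩
      have hr : M ++ [p] ~r p :: M := List.isRotated_append
      refine hr.trans (ih hG' (h₁.isRotated hr) ?_)
      rw [h, ← mul_mk, ← List.singleton_append (l := M), ← mul_mk (L₂ := M)]
      group
    exfalso
    have hred : IsReduced ((G ++ [p]) ++ L₁ ++ invRev (G ++ [p])) := by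
      refine IsReduced.append_overlap ?_ ?_ hne
      · rw [IsReduced, List.isChain_append]
        refine ⟨hG, h₁.isReduced, ?_⟩
        intro x hx y hy hxy
        rw [List.head?_eq_some_head hne] at hy
        simp only [List.getLast?_append, List.getLast?_singleton, Option.some_or,
          Option.mem_def, Option.some.injEq] at hx hy
        subst hx hy
        by_contra hc
        exact hd (Prod.ext hxy.symm (by simpa using (Bool.eq_not_of_ne (Ne.symm hc))))
      · rw [IsReduced, List.isChain_append]
        refine ⟨h₁.isReduced, hG.invRev, ?_⟩
        intro x hx y hy hxy
        rw [List.getLast?_eq_some_getLast hne] at hx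
        simp [FreeGroup.invRev] at hx hy
        subst hx hy
        by_contra hc
        exact hl (Prod.ext hxy (by simpa using (Bool.eq_not_of_ne hc)))
    have hL : L₂ = (G ++ [p]) ++ L₁ ++ invRev (G ++ [p]) := by
      refine h₂.isReduced.mk_injective hred ?_
      rw [h, ← mul_mk, ← mul_mk, ← mul_mk, ← inv_mk, ← mul_mk]
      group
    obtain ⟨q, G₀, hq⟩ : ∃ q G₀, G ++ [p] = q :: G₀ := List.exists_cons_of_ne_nil (by simp)
    have hq' : invRev [q] = [(q.1, !q.2)] := by simp [FreeGroup.invRev]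
    rw [hq, invRev_cons, hq', ← List.append_assoc] at hL
    have := h₂.2 (q.1, !q.2) (by rw [hL, List.getLast?_concat]; rfl) q (by simp [hL]) rfl
    simp at this

theorem IsCyclicallyReduced.isRotated_of_isConj (h₁ : IsCyclicallyReduced L₁)
    (h₂ : IsCyclicallyReduced L₂) (h : IsConj (mk L₁) (mk L₂)) : L₁ ~r L₂ := by
  classical
  obtain ⟨c, hc⟩ := isConj_iff.1 h
  exact isRotated_of_mk_conj (G := c.toWord) isReduced_toWord h₁ h₂ (by rw [mk_toWord, hc])

theorem IsCyclicallyReduced.isReduced_cons {a : α × Bool} (h : IsCyclicallyReduced L)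
    (ha : L.getLast? = some a) : IsReduced (a :: L) := by
  cases L with
  | nil => simp
  | cons b L => exact isReduced_cons_cons.2 ⟨h.2 a ha b rfl, h.1⟩

theorem isConj_mk_of_isRotated (h : L₁ ~r L₂) : IsConj (mk L₁) (mk L₂) := by
  obtain ⟨n, hn, rfl⟩ := List.isRotated_iff_mod.1 h
  rw [List.rotate_eq_drop_append_take hn, isConj_iff, ← mul_mk]
  refine ⟨(mk (L₁.take n))⁻¹, ?_⟩
  conv_lhs => rw [← List.take_append_drop n L₁, ← mul_mk]
  simp only [List.take_append_drop]
  group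

theorem exists_isCyclicallyReduced_isConj [DecidableEq α] (w : FreeGroup α) :
    ∃ L, IsCyclicallyReduced L ∧ IsConj w (mk L) ∧ ∀ p ∈ L, p ∈ w.toWord := by
  have h := reduceCyclically.conj_conjugator_reduceCyclically w.toWord
  refine ⟨reduceCyclically w.toWord, reduceCyclically.isCyclicallyReduced isReduced_toWord,
    ?_, fun p hp => ?_⟩
  · have h' := congrArg mk h
    rw [← mul_mk, ← mul_mk, ← inv_mk, mk_toWord] at h'
    exact (isConj_iff.2 ⟨_, h'⟩).symm
  · rw [← h]; simp [hp]

theorem IsReduced.cons_append_cons {p q : α × Bool} {P R : List (α × Bool)}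
    (hP : IsReduced P) (hne : P ≠ []) (hp : ∀ x ∈ P, x.1 ≠ p.1) (hq : ∀ x ∈ P, x.1 ≠ q.1)
    (hR : IsReduced (q :: R)) : IsReduced (p :: (P ++ q :: R)) := by
  have h1 : IsReduced (P ++ q :: R) := by
    rw [IsReduced, List.isChain_append]
    refine ⟨hP, hR, fun x hx y hy hxy => ?_⟩
    simp only [List.head?_cons, Option.mem_def, Option.some.injEq] at hy
    subst hy
    exact absurd hxy (hq x (List.mem_of_mem_getLast? hx))
  rw [IsReduced, List.isChain_cons]
  refine ⟨fun y hy hxy => ?_, h1⟩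
  rw [List.head?_append_of_ne_nil _ hne] at hy
  exact absurd hxy.symm (hp y (List.mem_of_mem_head? hy))

/-- The subgroup of the free group consisting of the elements not involving the letter `v`. -/
def offLetter (v : α) : Subgroup (FreeGroup α) := Subgroup.closure (of '' {v}ᶜ)

variable {v : α}

theorem of_mem_offLetter {x : α} (h : x ≠ v) : of x ∈ offLetter v :=
  Subgroup.subset_closure ⟨x, h, rfl⟩

theorem mk_mem_offLetter (h : ∀ p ∈ L, p.1 ≠ v) : mk L ∈ offLetter v := by
  induction L with
  | nil => exact one_mem _
  | cons p L ih =>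
    rw [← List.singleton_append, ← mul_mk]
    refine mul_mem ?_ (ih fun q hq => h q (by simp [hq]))
    obtain ⟨x, b⟩ := p
    have hx := of_mem_offLetter (h (x, b) (by simp))
    cases b
    · have := inv_mem hx
      rwa [of, inv_mk] at this
    · exact hx

theorem mem_offLetter_iff [DecidableEq α] {g : FreeGroup α} :
    g ∈ offLetter v ↔ ∀ p ∈ g.toWord, p.1 ≠ v := by
  refine ⟨fun hg => ?_, fun h => by simpa [mk_toWord] using mk_mem_offLetter h⟩
  induction hg using Subgroup.closure_induction with
  | mem x hx => obtain ⟨y, hy, rfl⟩ := hx; simpa using hy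
  | one => simp
  | mul x y _ _ hx hy =>
    intro p hp
    rcases List.mem_append.1 ((toWord_mul_sublist x y).subset hp) with h | h
    exacts [hx p h, hy p h]
  | inv x _ hx =>
    intro p hp
    rw [toWord_inv] at hp
    simp only [FreeGroup.invRev, List.mem_reverse, List.mem_map] at hp
    obtain ⟨q, hq, rfl⟩ := hp
    exact hx q hq

end FreeGroup

section Words

open FreeGroup

variable {X : Type}

theorem reducedList_iff {L : List (X × Bool)} : ReducedList L ↔ FreeGroup.IsReduced L := by
  simp only [ReducedList, FreeGroup.IsReduced, ← imp_iff_not_or, ne_eq]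
  rfl

theorem cyclRed_iff [DecidableEq X] {w : FreeGroup X} :
    CyclRed w ↔ IsCyclicallyReduced w.toWord := by
  refine ⟨fun h => ⟨isReduced_toWord, fun a ha b hb => ?_⟩,
    fun h l hl => reducedList_iff.2 (h.isRotated hl).isReduced⟩
  cases hw : w.toWord with
  | nil => simp [hw] at ha
  | cons p M =>
    have hr := reducedList_iff.1 (h (M ++ [p]) (by rw [hw]; exact ⟨1, by simp⟩))
    rw [hw] at ha hb
    simp only [List.head?_cons, Option.mem_def, Option.some.injEq] at hb
    subst hb
    rcases eq_or_ne M [] with rfl | hM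
    · simp_all
    · rw [FreeGroup.IsReduced, List.isChain_append] at hr
      refine hr.2.2 a ?_ p (by simp)
      rwa [← List.singleton_append, List.getLast?_append_of_ne_nil _ hM] at ha

end Words

section Alternating

open FreeGroup

/-- The entries of the list are pairs of nontrivial elements of `U` and `K`. -/
def IsAlt {G : Type} [Group G] (U K : Subgroup G) (B : List (G × G)) : Prop :=
  ∀ p ∈ B, (p.1 ∈ U ∧ p.1 ≠ 1) ∧ p.2 ∈ K ∧ p.2 ≠ 1

theorem IsAlt.append {G : Type} [Group G] {U K : Subgroup G} {B B' : List (G × G)}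
    (h : IsAlt U K B) (h' : IsAlt U K B') : IsAlt U K (B ++ B') := by
  intro p hp
  rcases List.mem_append.1 hp with hp | hp
  exacts [h p hp, h' p hp]

theorem isAlt_singleton {G : Type} [Group G] {U K : Subgroup G} {u k : G} (hu : u ∈ U)
    (hu1 : u ≠ 1) (hk : k ∈ K) (hk1 : k ≠ 1) : IsAlt U K [(u, k)] := by
  rintro p hp
  obtain rfl := List.mem_singleton.1 hp
  exact ⟨⟨hu, hu1⟩, hk, hk1⟩

variable {X : Type} [DecidableEq X]

/-- The word `u₁ ℓ k₁ ℓ⁻¹ u₂ ℓ k₂ ℓ⁻¹ ⋯` associated with the list of pairs `(uᵢ, kᵢ)`. -/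
def altWord (l : X × Bool) (B : List (FreeGroup X × FreeGroup X)) : List (X × Bool) :=
  B.flatMap fun p => p.1.toWord ++ l :: (p.2.toWord ++ [(l.1, !l.2)])

variable {l : X × Bool} {U K : Subgroup (FreeGroup X)} {B B' : List (FreeGroup X × FreeGroup X)}

@[simp] theorem altWord_nil : altWord l [] = [] := rfl

theorem altWord_cons (p : FreeGroup X × FreeGroup X) : altWord l (p :: B) =
    p.1.toWord ++ l :: (p.2.toWord ++ (l.1, !l.2) :: altWord l B) := by
  simp [altWord]

theorem altWord_append : altWord l (B ++ B') = altWord l B ++ altWord l B' := by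
  simp [altWord]

theorem mk_altWord : mk (altWord l B) =
    (B.map fun p => p.1 * mk [l] * p.2 * (mk [l])⁻¹).prod := by
  induction B with
  | nil => rfl
  | cons p B ih =>
    have : (mk [l] : FreeGroup X)⁻¹ = mk [(l.1, !l.2)] := by simp [inv_mk, invRev]
    rw [altWord_cons, List.map_cons, List.prod_cons, ← ih, ← mul_mk, ← List.singleton_append,
      ← mul_mk, ← mul_mk, ← List.singleton_append (l := altWord l B), ← mul_mk, mk_toWord,
      mk_toWord, this]
    group

theorem toWord_ne_nil {g : FreeGroup X} (h : g ≠ 1) : g.toWord ≠ [] := fun h' =>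
  h (toWord_eq_nil_iff.1 h')

theorem IsAlt.isReduced_cons (hU : U ≤ offLetter l.1) (hK : K ≤ offLetter l.1)
    (h : IsAlt U K B) : FreeGroup.IsReduced ((l.1, !l.2) :: altWord l B) := by
  induction B with
  | nil => simp
  | cons p B ih =>
    obtain ⟨⟨hu, hu1⟩, hk, hk1⟩ := h p (by simp)
    rw [altWord_cons]
    have hu' := mem_offLetter_iff.1 (hU hu)
    have hk' := mem_offLetter_iff.1 (hK hk)
    exact isReduced_toWord.cons_append_cons (toWord_ne_nil hu1) hu' hu'
      (isReduced_toWord.cons_append_cons (toWord_ne_nil hk1) hk' hk'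
        (ih fun q hq => h q (by simp [hq])))

theorem IsAlt.isCyclicallyReduced (hU : U ≤ offLetter l.1) (hK : K ≤ offLetter l.1)
    (h : IsAlt U K B) : IsCyclicallyReduced (altWord l B) := by
  apply IsReduced.isCyclicallyReduced_of_append_self
  rw [← altWord_append]
  exact ((h.append h).isReduced_cons hU hK).infix ⟨[(l.1, !l.2)], [], by simp⟩

theorem mem_altWord (hB : B ≠ []) : l ∈ altWord l B := by
  obtain ⟨p, B, rfl⟩ := List.exists_cons_of_ne_nil hB
  simp [altWord_cons]

theorem getLast?_altWord (hB : B ≠ []) : (altWord l B).getLast? = some (l.1, !l.2) := by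
  obtain ⟨B, p, rfl⟩ := List.eq_nil_or_concat' B |>.resolve_left hB
  rw [altWord_append, altWord_cons, altWord_nil, ← List.cons_append, ← List.append_assoc,
    ← List.append_assoc, List.getLast?_concat]

theorem altWord_eq_append (hU : U ≤ offLetter l.1) (hK : K ≤ offLetter l.1)
    (h : IsAlt U K B) {Y Z : List (X × Bool)} (hYZ : altWord l B = Y ++ Z)
    (hY : Y.getLast? = some (l.1, !l.2)) :
    ∃ B₁ B₂, B = B₁ ++ B₂ ∧ Y = altWord l B₁ ∧ Z = altWord l B₂ := by
  induction B generalizing Y with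
  | nil => simp_all
  | cons p B ih =>
    obtain ⟨⟨hu, -⟩, hk, -⟩ := h p (by simp)
    have hu' := mem_offLetter_iff.1 (hU hu)
    have hk' := mem_offLetter_iff.1 (hK hk)
    have hB : IsAlt U K B := fun q hq => h q (by simp [hq])
    obtain ⟨Y', rfl⟩ := List.getLast?_eq_some_iff.1 hY
    have hnot : (l.1, !l.2) ∉ p.1.toWord ++ l :: p.2.toWord := by
      intro hmem
      rcases List.mem_append.1 hmem with hmem | hmem
      · exact hu' _ hmem rfl
      rcases List.mem_cons.1 hmem with hmem | hmem
      · simpa using congrArg Prod.snd hmem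
      · exact hk' _ hmem rfl
    have heq : (p.1.toWord ++ l :: p.2.toWord) ++ ((l.1, !l.2) :: altWord l B) =
        Y' ++ ((l.1, !l.2) :: Z) := by
      rw [altWord_cons] at hYZ
      simpa using hYZ
    rcases List.append_eq_append_iff.1 heq with ⟨W, hW, hW'⟩ | ⟨W, hW, hW'⟩
    · cases W with
      | nil =>
        simp only [List.nil_append, List.cons.injEq, true_and] at hW'
        refine ⟨[p], B, rfl, ?_, hW'.symm⟩
        rw [hW, altWord_cons]
        simp
      | cons q W =>
        simp only [List.cons_append, List.cons.injEq] at hW'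
        obtain ⟨rfl, hW'⟩ := hW'
        obtain ⟨B₁, B₂, rfl, h1, h2⟩ := ih hB (Y := W ++ [(l.1, !l.2)]) (by simpa using hW')
          (by simp)
        refine ⟨p :: B₁, B₂, rfl, ?_, h2⟩
        rw [hW, altWord_cons, ← h1]
        simp
    · cases W with
      | nil =>
        simp only [List.nil_append, List.cons.injEq, true_and] at hW'
        refine ⟨[p], B, rfl, ?_, hW'⟩
        rw [List.append_nil] at hW
        rw [← hW, altWord_cons]
        simp
      | cons q W =>
        simp only [List.cons_append, List.cons.injEq] at hW'
        obtain ⟨rfl, -⟩ := hW'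
        exact absurd (by rw [hW]; simp) hnot

theorem exists_altWord_of_isRotated (hU : U ≤ offLetter l.1) (hK : K ≤ offLetter l.1)
    (h : IsAlt U K B) {L : List (X × Bool)} (hr : L ~r altWord l B)
    (hL : L.getLast? = some (l.1, !l.2)) : ∃ B', IsAlt U K B' ∧ L = altWord l B' := by
  obtain ⟨n, hn, rfl⟩ := List.isRotated_iff_mod.1 hr.symm
  rw [List.rotate_eq_drop_append_take hn] at hL ⊢
  rcases eq_or_ne ((altWord l B).take n) [] with h0 | h0
  · refine ⟨B, h, ?_⟩
    conv_rhs => rw [← List.take_append_drop n (altWord l B)]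
    simp [h0]
  · rw [List.getLast?_append_of_ne_nil _ h0] at hL
    obtain ⟨B₁, B₂, rfl, h1, h2⟩ := altWord_eq_append hU hK h
      (List.take_append_drop n (altWord l B)).symm hL
    refine ⟨B₂ ++ B₁, fun p hp => h p ?_, ?_⟩
    · simpa [or_comm] using hp
    · rw [h1, h2, altWord_append]

/-- The conjugates of `H` are, up to conjugation, elements of `F(X ∖ {l})` and alternating
products `u₁ l k₁ l⁻¹ u₂ l k₂ l⁻¹ ⋯` with `uᵢ ∈ U`, `kᵢ ∈ K`, and all of the latter occur. -/
structure IsAlternating (H : Subgroup (FreeGroup X)) (l : X × Bool)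
    (U K : Subgroup (FreeGroup X)) : Prop where
  left_le : U ≤ offLetter l.1
  right_le : K ≤ offLetter l.1
  exists_left : ∃ u ∈ U, u ≠ 1
  exists_right : ∃ k ∈ K, k ≠ 1
  le_zpowers : ∃ c, U ≤ Subgroup.zpowers c
  of_conj_mem : ∀ w : FreeGroup X, (∃ c, c * w * c⁻¹ ∈ H) →
    (∃ n ∈ offLetter l.1, IsConj w n) ∨
      ∃ B, B ≠ [] ∧ IsAlt U K B ∧ IsConj w (mk (altWord l B))
  conj_mem : ∀ B, B ≠ [] → IsAlt U K B → ∃ c, c * mk (altWord l B) * c⁻¹ ∈ H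

theorem exists_isAlt_map {G G' : Type} [Group G] [Group G'] {U K : Subgroup G} {f g : G →* G'}
    {B : List (G' × G')} (h : IsAlt (U.map f) (K.map g) B) :
    ∃ B', IsAlt U K B' ∧ B = B'.map (Prod.map f g) := by
  induction B with
  | nil => exact ⟨[], by simp [IsAlt], rfl⟩
  | cons p B ih =>
    obtain ⟨B', hB', rfl⟩ := ih fun q hq => h q (by simp [hq])
    obtain ⟨⟨⟨u, hu, hu'⟩, hu1⟩, ⟨k, hk, hk'⟩, hk1⟩ := h p (by simp)
    refine ⟨(u, k) :: B', ?_, ?_⟩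
    · intro q hq
      rcases List.mem_cons.1 hq with rfl | hq
      · refine ⟨⟨hu, ?_⟩, hk, ?_⟩
        · rintro rfl; exact hu1 (by rw [← hu', _root_.map_one])
        · rintro rfl; exact hk1 (by rw [← hk', _root_.map_one])
      · exact hB' q hq
    · simp [hu', hk']

theorem IsAlt.map {G G' : Type} [Group G] [Group G'] {U K : Subgroup G} {f g : G →* G'}
    (hf : Function.Injective f) (hg : Function.Injective g) {B : List (G × G)}
    (h : IsAlt U K B) : IsAlt (U.map f) (K.map g) (B.map (Prod.map f g)) := by
  intro q hq
  obtain ⟨p, hp, rfl⟩ := List.mem_map.1 hq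
  obtain ⟨⟨hu, hu1⟩, hk, hk1⟩ := h p hp
  exact ⟨⟨⟨_, hu, rfl⟩, (map_ne_one_iff f hf).2 hu1⟩, ⟨_, hk, rfl⟩, (map_ne_one_iff g hg).2 hk1⟩

theorem IsAlternating.map {H : Subgroup (FreeGroup X)} (h : IsAlternating H l U K)
    (φ : FreeGroup X ≃* FreeGroup X) (hφ : ∀ g ∈ offLetter l.1, φ g ∈ offLetter l.1)
    {s t : FreeGroup X} (hs : s ∈ offLetter l.1) (ht : t ∈ offLetter l.1)
    (hl : φ (FreeGroup.mk [l]) = s * FreeGroup.mk [l] * t) :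
    ∃ U' K', IsAlternating (H.map φ.toMonoidHom) l U' K' := by
  let f : FreeGroup X →* FreeGroup X := (φ.trans (MulAut.conj s⁻¹)).toMonoidHom
  let g : FreeGroup X →* FreeGroup X := (φ.trans (MulAut.conj t)).toMonoidHom
  have hfa : ∀ x, f x = s⁻¹ * φ x * s := fun x => by simp [f]
  have hga : ∀ x, g x = t * φ x * t⁻¹ := fun x => by simp [g]
  have hf : Function.Injective f := (φ.trans (MulAut.conj s⁻¹)).injective
  have hg : Function.Injective g := (φ.trans (MulAut.conj t)).injective
  have key : ∀ B, FreeGroup.mk (altWord l (B.map (Prod.map f g))) =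
      s⁻¹ * φ (FreeGroup.mk (altWord l B)) * s := by
    intro B
    rw [mk_altWord, mk_altWord]
    induction B with
    | nil => simp
    | cons p B ih =>
      rw [List.map_cons, List.map_cons, List.prod_cons, ih, List.map_cons, List.prod_cons]
      simp only [_root_.map_mul, _root_.map_inv, hl, Prod.map, hfa, hga]
      group
  have key' : ∀ B, IsConj (φ (FreeGroup.mk (altWord l B)))
      (FreeGroup.mk (altWord l (B.map (Prod.map f g)))) :=
    fun B => isConj_iff.2 ⟨s⁻¹, by rw [key, inv_inv]⟩
  refine ⟨U.map f, K.map g, ?_, ?_, ?_, ?_, ?_, ?_, ?_⟩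
  · rintro _ ⟨u, hu, rfl⟩
    rw [hfa]
    exact mul_mem (mul_mem (inv_mem hs) (hφ u (h.left_le hu))) hs
  · rintro _ ⟨u, hu, rfl⟩
    rw [hga]
    exact mul_mem (mul_mem ht (hφ u (h.right_le hu))) (inv_mem ht)
  · obtain ⟨u, hu, hu1⟩ := h.exists_left
    exact ⟨f u, ⟨u, hu, rfl⟩, (map_ne_one_iff f hf).2 hu1⟩
  · obtain ⟨u, hu, hu1⟩ := h.exists_right
    exact ⟨g u, ⟨u, hu, rfl⟩, (map_ne_one_iff g hg).2 hu1⟩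
  · obtain ⟨c, hc⟩ := h.le_zpowers
    refine ⟨f c, ?_⟩
    rw [← MonoidHom.map_zpowers]
    exact Subgroup.map_mono hc
  · rintro w ⟨c, x, hx, hxw⟩
    have hw : IsConj (φ x) w := (isConj_iff.2 ⟨c, hxw.symm⟩).symm
    rcases h.of_conj_mem x ⟨1, by simpa using hx⟩ with ⟨n, hn, hxn⟩ | ⟨B, hB, hB', hxB⟩
    · exact Or.inl ⟨φ n, hφ n hn, hw.symm.trans (φ.toMonoidHom.map_isConj hxn)⟩
    · exact Or.inr ⟨_, by simpa using hB, hB'.map hf hg,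
        (hw.symm.trans (φ.toMonoidHom.map_isConj hxB)).trans (key' B)⟩
  · intro B hB hB'
    obtain ⟨B, hB₀, rfl⟩ := exists_isAlt_map hB'
    obtain ⟨c, hc⟩ := h.conj_mem B (by simpa using hB) hB₀
    refine ⟨φ c * s, _, hc, ?_⟩
    rw [key]
    simp [_root_.map_mul, mul_assoc]

theorem IsWhiteheadII.map_offLetter {φ : FreeGroup X ≃* FreeGroup X} {C : Finset (X × Bool)}
    {m : X × Bool} (hφ : IsWhiteheadII φ C m) {v : X} (hm : m.1 ≠ v) :
    (∀ g ∈ offLetter v, φ g ∈ offLetter v) ∧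
      ∀ b, ∃ s ∈ offLetter v, ∃ t ∈ offLetter v,
        φ (FreeGroup.mk [(v, b)]) = s * FreeGroup.mk [(v, b)] * t := by
  have hiota : iota m ∈ offLetter v := by
    unfold iota
    split_ifs
    exacts [of_mem_offLetter hm, inv_mem (of_mem_offLetter hm)]
  have h1 : ∀ x : X, (if (x, false) ∈ C then (iota m)⁻¹ else 1) ∈ offLetter v := fun x => by
    split_ifs
    exacts [inv_mem hiota, one_mem _]
  have h2 : ∀ x : X, (if (x, true) ∈ C then iota m else 1) ∈ offLetter v := fun x => by
    split_ifs
    exacts [hiota, one_mem _]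
  refine ⟨fun g hg => ?_, fun b => ?_⟩
  · induction hg using Subgroup.closure_induction with
    | mem x hx =>
      obtain ⟨y, hy, rfl⟩ := hx
      rw [hφ.2.2]
      by_cases hym : y = m.1
      · rw [if_pos hym]
        exact of_mem_offLetter hy
      · rw [if_neg hym]
        exact mul_mem (mul_mem (h1 y) (of_mem_offLetter hy)) (h2 y)
    | one => simp
    | mul x y _ _ hx hy => rw [_root_.map_mul]; exact mul_mem hx hy
    | inv x _ hx => rw [_root_.map_inv]; exact inv_mem hx
  · have hv := hφ.2.2 v
    rw [if_neg (Ne.symm hm)] at hv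
    cases b
    · refine ⟨_, inv_mem (h2 v), _, inv_mem (h1 v), ?_⟩
      have : (FreeGroup.mk [(v, false)] : FreeGroup X) = (of v)⁻¹ := by simp [of, inv_mk, invRev]
      rw [this, _root_.map_inv, hv]
      group
    · exact ⟨_, h1 v, _, h2 v, hv⟩

end Alternating

namespace XDigraph

open FreeGroup

variable {X : Type} {S : XDigraph X}

@[simp] theorem dInit_dRev (d : S.Dart) : S.dInit (S.dRev d) = S.dTerm d := by
  rcases d with ⟨e, _ | _⟩ <;> rfl

@[simp] theorem dTerm_dRev (d : S.Dart) : S.dTerm (S.dRev d) = S.dInit d := by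
  rcases d with ⟨e, _ | _⟩ <;> rfl

@[simp] theorem dRev_dRev (d : S.Dart) : S.dRev (S.dRev d) = d := by
  rcases d with ⟨e, _ | _⟩ <;> rfl

theorem dRev_injective : Function.Injective S.dRev :=
  Function.LeftInverse.injective dRev_dRev

theorem Folded.dart_ext (hF : S.Folded) {d d' : S.Dart} (h : S.dInit d = S.dInit d')
    (hl : S.dLab d = S.dLab d') : d = d' := by
  apply dRev_injective
  refine hF _ (dTerm_dRev d) (by simp [h]) ?_
  simpa [dLab, dRev, Prod.ext_iff] using hl

/-- The list of darts `p` is a walk from `x` to `y`. -/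
def IsWalk : S.V → List S.Dart → S.V → Prop
  | x, [], y => x = y
  | x, d :: p, y => S.dInit d = x ∧ IsWalk (S.dTerm d) p y

@[simp] theorem isWalk_nil {x y : S.V} : S.IsWalk x [] y ↔ x = y := Iff.rfl

@[simp] theorem isWalk_cons {x y : S.V} {d : S.Dart} {p : List S.Dart} :
    S.IsWalk x (d :: p) y ↔ S.dInit d = x ∧ S.IsWalk (S.dTerm d) p y := Iff.rfl

theorem isWalk_append {x z : S.V} {p q : List S.Dart} :
    S.IsWalk x (p ++ q) z ↔ ∃ y, S.IsWalk x p y ∧ S.IsWalk y q z := by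
  induction p generalizing x with
  | nil => simp
  | cons d p ih => simp [ih, and_assoc]

theorem IsWalk.append {x y z : S.V} {p q : List S.Dart} (hp : S.IsWalk x p y)
    (hq : S.IsWalk y q z) : S.IsWalk x (p ++ q) z := isWalk_append.2 ⟨y, hp, hq⟩

theorem IsWalk.invRev {x y : S.V} {p : List S.Dart} (h : S.IsWalk x p y) :
    S.IsWalk y (invRev p) x := by
  induction p generalizing x with
  | nil => exact h.symm
  | cons d p ih =>
    have : FreeGroup.invRev (d :: p) = FreeGroup.invRev p ++ [S.dRev d] := by
      simp [FreeGroup.invRev, dRev]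
    rw [this]
    exact (ih h.2).append (by simpa using h.1)

theorem IsWalk.right_unique {x y z : S.V} {p : List S.Dart} (h : S.IsWalk x p y)
    (h' : S.IsWalk x p z) : y = z := by
  induction p generalizing x with
  | nil => exact h.symm.trans h'
  | cons d p ih => exact ih h.2 h'.2

theorem IsWalk.red {x y : S.V} {p q : List S.Dart} (h : S.IsWalk x p y) (hr : Red p q) :
    S.IsWalk x q y := by
  induction hr with
  | refl => exact h
  | tail _ hs ih =>
    cases hs with
    | @not L₁ L₂ e b =>
      obtain ⟨z, h1, h2, h3, h4⟩ := isWalk_append.1 ih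
      refine h1.append ?_
      have : S.dTerm (e, !b) = z := by
        rw [← h2, ← dTerm_dRev]; rfl
      rwa [this] at h4

theorem IsWalk.reduce {x y : S.V} {p : List S.Dart} (h : S.IsWalk x p y) :
    S.IsWalk x (reduce p) y := h.red FreeGroup.reduce.red

theorem IsWalk.isReduced_map (hF : S.Folded) {x y : S.V} {p : List S.Dart} (h : S.IsWalk x p y)
    (hp : FreeGroup.IsReduced p) : FreeGroup.IsReduced (p.map S.dLab) := by
  induction p generalizing x with
  | nil => simp
  | cons d p ih =>
    cases p with
    | nil => simp
    | cons f p =>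
      simp only [List.map_cons, isReduced_cons_cons] at hp ⊢
      refine ⟨fun hl => ?_, ih h.2 hp.2⟩
      by_contra hne
      have hb : f.2 = !d.2 := by
        simp only [dLab] at hne
        cases hf : f.2 <;> cases hd : d.2 <;> simp_all
      have hfd : f = S.dRev d := hF.dart_ext (by simp [h.2.1]) (by
        simp only [dLab, dRev] at hl ⊢
        rw [hb, ← hl])
      have h1 := hp.1 (by rw [hfd, dRev])
      rw [hb] at h1
      simp at h1

theorem IsWalk.unique (hF : S.Folded) {x y z : S.V} {p q : List S.Dart} (hp : S.IsWalk x p y)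
    (hq : S.IsWalk x q z) (h : p.map S.dLab = q.map S.dLab) : p = q := by
  induction p generalizing x q with
  | nil => simpa using h.symm
  | cons d p ih =>
    cases q with
    | nil => simp at h
    | cons f q =>
      simp only [List.map_cons, List.cons.injEq] at h
      obtain rfl := hF.dart_ext (hp.1.trans hq.1.symm) h.1
      rw [ih hp.2 hq.2 h.2]

theorem isWalk_iff {x y : S.V} {d : S.Dart} {p : List S.Dart} : S.IsWalk x (d :: p) y ↔
    S.IsPath (d :: p) ∧ S.dInit d = x ∧ S.dTerm ((d :: p).getLast (by simp)) = y := by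
  induction p generalizing x d with
  | nil => simp [show S.IsPath [d] from List.isChain_singleton d]
  | cons f p ih =>
    have : S.IsPath (d :: f :: p) ↔ S.dTerm d = S.dInit f ∧ S.IsPath (f :: p) :=
      List.isChain_cons_cons
    rw [isWalk_cons, ih, this]
    simp only [List.getLast_cons_cons]
    tauto

theorem immersed_iff {p : List S.Dart} : S.Immersed p ↔ FreeGroup.IsReduced p := by
  change List.IsChain _ p ↔ List.IsChain _ p
  have : (fun d d' : S.Dart => d' ≠ S.dRev d) = fun a b => a.1 = b.1 → a.2 = b.2 := by
    funext d d'
    rcases d with ⟨e, _ | _⟩ <;> rcases d' with ⟨e', _ | _⟩ <;> simp [dRev, eq_comm]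
  rw [this]

/-- The word `L` is the label of a walk from `x` to `y`. -/
def ReadsFrom (x : S.V) (L : List (X × Bool)) (y : S.V) : Prop :=
  ∃ p, S.IsWalk x p y ∧ p.map S.dLab = L

@[simp] theorem readsFrom_nil {x y : S.V} : S.ReadsFrom x [] y ↔ x = y := by
  simp [ReadsFrom]

theorem readsFrom_append {x z : S.V} {L M : List (X × Bool)} :
    S.ReadsFrom x (L ++ M) z ↔ ∃ y, S.ReadsFrom x L y ∧ S.ReadsFrom y M z := by
  constructor
  · rintro ⟨p, hp, h⟩
    obtain ⟨q, r, rfl, rfl, rfl⟩ := List.map_eq_append_iff.1 h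
    obtain ⟨y, h1, h2⟩ := isWalk_append.1 hp
    exact ⟨y, ⟨q, h1, rfl⟩, r, h2, rfl⟩
  · rintro ⟨y, ⟨q, h1, rfl⟩, r, h2, rfl⟩
    exact ⟨q ++ r, h1.append h2, by simp⟩

theorem readsFrom_cons {x z : S.V} {a : X × Bool} {L : List (X × Bool)} :
    S.ReadsFrom x (a :: L) z ↔
      ∃ d, S.dInit d = x ∧ S.dLab d = a ∧ S.ReadsFrom (S.dTerm d) L z := by
  constructor
  · rintro ⟨p, hp, h⟩
    obtain ⟨d, p, rfl, rfl, rfl⟩ := List.map_eq_cons_iff.1 h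
    exact ⟨d, hp.1, rfl, p, hp.2, rfl⟩
  · rintro ⟨d, h, rfl, p, hp, rfl⟩
    exact ⟨d :: p, ⟨h, hp⟩, rfl⟩

theorem ReadsFrom.append {x y z : S.V} {L M : List (X × Bool)} (h : S.ReadsFrom x L y)
    (h' : S.ReadsFrom y M z) : S.ReadsFrom x (L ++ M) z := readsFrom_append.2 ⟨y, h, h'⟩

theorem readsFrom_singleton (d : S.Dart) : S.ReadsFrom (S.dInit d) [S.dLab d] (S.dTerm d) :=
  readsFrom_cons.2 ⟨d, rfl, rfl, by simp⟩

theorem readsFrom_singleton_rev (d : S.Dart) :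
    S.ReadsFrom (S.dTerm d) [((S.dLab d).1, !(S.dLab d).2)] (S.dInit d) := by
  have h := readsFrom_singleton (S.dRev d)
  rwa [dInit_dRev, dTerm_dRev] at h

theorem ReadsFrom.exists_dart_of_getLast? {l : X × Bool} {x y : S.V} {L : List (X × Bool)}
    (hL : S.ReadsFrom x L y) (hl : L.getLast? = some (l.1, !l.2)) :
    ∃ d : S.Dart, S.dLab d = l ∧ S.dInit d = y := by
  obtain ⟨L, rfl⟩ := List.getLast?_eq_some_iff.1 hl
  obtain ⟨_, -, hr⟩ := readsFrom_append.1 hL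
  obtain ⟨f, rfl, hf, hy⟩ := readsFrom_cons.1 hr
  obtain rfl := readsFrom_nil.1 hy
  refine ⟨S.dRev f, ?_, by simp⟩
  simpa [dLab, dRev, Prod.ext_iff, Bool.eq_not] using hf

theorem ReadsFrom.invRev {x y : S.V} {L : List (X × Bool)} (h : S.ReadsFrom x L y) :
    S.ReadsFrom y (invRev L) x := by
  obtain ⟨p, hp, rfl⟩ := h
  exact ⟨_, hp.invRev, by simp [FreeGroup.invRev, dLab]⟩

theorem ReadsFrom.right_unique (hF : S.Folded) {x y z : S.V} {L : List (X × Bool)}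
    (h : S.ReadsFrom x L y) (h' : S.ReadsFrom x L z) : y = z := by
  obtain ⟨p, hp, rfl⟩ := h
  obtain ⟨q, hq, h'⟩ := h'
  obtain rfl := hp.unique hF hq h'.symm
  exact hp.right_unique hq

theorem ReadsFrom.left_unique (hF : S.Folded) {x y z : S.V} {L : List (X × Bool)}
    (h : S.ReadsFrom x L z) (h' : S.ReadsFrom y L z) : x = y :=
  h.invRev.right_unique hF h'.invRev

theorem ReadsFrom.reduce [DecidableEq X] (hF : S.Folded) {x y : S.V} {L : List (X × Bool)}
    (h : S.ReadsFrom x L y) : S.ReadsFrom x (reduce L) y := by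
  obtain ⟨p, hp, rfl⟩ := h
  refine ⟨FreeGroup.reduce p, hp.reduce, ?_⟩
  have h1 := hp.reduce.isReduced_map hF (FreeGroup.IsReduced.of_reduce_eq FreeGroup.reduce.idem)
  have h2 : Red (p.map S.dLab) ((FreeGroup.reduce p).map S.dLab) := by
    have : ∀ q, Red p q → Red (p.map S.dLab) (q.map S.dLab) := fun q hq => by
      induction hq with
      | refl => exact Red.refl
      | tail _ hs ih =>
        refine ih.trans (Red.Step.to_red ?_)
        cases hs
        simp only [List.map_append, List.map_cons]
        exact Red.Step.not
    exact this _ FreeGroup.reduce.red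
  rw [← (FreeGroup.isReduced_iff_reduce_eq.1 h1), FreeGroup.reduce.eq_of_red h2]

theorem ReadsFrom.toWord_mk [DecidableEq X] (hF : S.Folded) {x y : S.V} {L : List (X × Bool)}
    (h : S.ReadsFrom x L y) : S.ReadsFrom x (FreeGroup.mk L).toWord y := by
  rw [FreeGroup.toWord_mk]
  exact h.reduce hF

theorem ReadsFrom.toWord_mul [DecidableEq X] (hF : S.Folded) {x y z : S.V} {g h : FreeGroup X}
    (hg : S.ReadsFrom x g.toWord y) (hh : S.ReadsFrom y h.toWord z) :
    S.ReadsFrom x (g * h).toWord z := by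
  rw [FreeGroup.toWord_mul]
  exact (hg.append hh).reduce hF

theorem ReadsFrom.toWord_inv [DecidableEq X] {x y : S.V} {g : FreeGroup X}
    (hg : S.ReadsFrom x g.toWord y) : S.ReadsFrom y g⁻¹.toWord x := by
  rw [FreeGroup.toWord_inv]
  exact hg.invRev

theorem ReadsFrom.exists_of_isRotated {x : S.V} {L M : List (X × Bool)} (h : S.ReadsFrom x L x)
    (hr : L ~r M) : ∃ y, S.ReadsFrom y M y := by
  obtain ⟨n, hn, rfl⟩ := List.isRotated_iff_mod.1 hr
  rw [List.rotate_eq_drop_append_take hn]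
  rw [← List.take_append_drop n L] at h
  obtain ⟨y, h1, h2⟩ := readsFrom_append.1 h
  exact ⟨y, h2.append h1⟩

theorem reads_iff [DecidableEq X] {x : S.V} {w : FreeGroup X} :
    Reads S x w ↔ S.ReadsFrom x w.toWord x := by
  constructor
  · rintro ⟨p, -, ⟨hp, hx⟩, hl⟩
    refine ⟨p, ?_, hl⟩
    cases p with
    | nil => rfl
    | cons d p => exact isWalk_iff.2 ⟨hp, hx (by simp)⟩
  · rintro ⟨p, hp, hl⟩
    refine ⟨p, ?_, ?_, hl⟩
    · have hr : FreeGroup.IsReduced (p.map S.dLab) := hl ▸ isReduced_toWord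
      have := (List.isChain_map S.dLab).1 hr
      exact immersed_iff.2 (this.imp fun a b h hab => h (by simp [dLab, hab]))
    · cases p with
      | nil => exact ⟨List.isChain_nil, fun h => absurd rfl h⟩
      | cons d p => exact ⟨(isWalk_iff.1 hp).1, fun _ => (isWalk_iff.1 hp).2⟩

theorem exists_readsFrom_iff [DecidableEq X] {H : Subgroup (FreeGroup X)} (h : CRep S H)
    {L : List (X × Bool)} (hL : IsCyclicallyReduced L) :
    (∃ x, S.ReadsFrom x L x) ↔ ∃ c, c * FreeGroup.mk L * c⁻¹ ∈ H := by
  have hw := hL.isReduced.toWord_mk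
  have := h.2.2.2 (FreeGroup.mk L) (cyclRed_iff.2 (by rwa [hw]))
  simpa only [reads_iff, hw] using this

theorem eqvGen_adjOn_iff {P : S.E → Prop} {x y : S.V} :
    Relation.EqvGen (S.AdjOn P) x y ↔ ∃ p, S.IsWalk x p y ∧ ∀ d ∈ p, P d.1 := by
  constructor
  · intro h
    induction h with
    | rel x y h =>
      obtain ⟨e, he, ⟨rfl, rfl⟩ | ⟨rfl, rfl⟩⟩ := h
      · exact ⟨[(e, true)], ⟨rfl, rfl⟩, by simpa using he⟩
      · exact ⟨[(e, false)], ⟨rfl, rfl⟩, by simpa using he⟩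
    | refl x => exact ⟨[], rfl, by simp⟩
    | symm x y _ ih =>
      obtain ⟨p, hp, h⟩ := ih
      refine ⟨_, hp.invRev, fun d hd => ?_⟩
      simp only [FreeGroup.invRev, List.mem_reverse, List.mem_map] at hd
      obtain ⟨f, hf, rfl⟩ := hd
      exact h f hf
    | trans x y z _ _ ih ih' =>
      obtain ⟨p, hp, h⟩ := ih
      obtain ⟨q, hq, h'⟩ := ih'
      refine ⟨_, hp.append hq, fun d hd => ?_⟩
      rcases List.mem_append.1 hd with hd | hd
      exacts [h d hd, h' d hd]
  · rintro ⟨p, hp, h⟩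
    induction p generalizing x with
    | nil => exact hp ▸ Relation.EqvGen.refl _
    | cons d p ih =>
      refine Relation.EqvGen.trans _ _ _ (Relation.EqvGen.rel _ _ ⟨d.1, h d (by simp), ?_⟩)
        (ih hp.2 fun f hf => h f (by simp [hf]))
      rcases d with ⟨e, _ | _⟩
      exacts [Or.inr ⟨rfl, hp.1⟩, Or.inl ⟨hp.1, rfl⟩]

theorem Connected.exists_isWalk (h : S.Connected) (x y : S.V) : ∃ p, S.IsWalk x p y := by
  have : Relation.EqvGen (S.AdjOn fun _ => True) x y := by
    refine Relation.EqvGen.mono ?_ _ _ (h.2 x y)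
    rintro u w ⟨⟨e, _ | _⟩, hu, hw⟩
    exacts [⟨e, trivial, Or.inr ⟨hw, hu⟩⟩, ⟨e, trivial, Or.inl ⟨hu, hw⟩⟩]
  obtain ⟨p, hp, -⟩ := eqvGen_adjOn_iff.1 this
  exact ⟨p, hp⟩

end XDigraph

namespace XDigraph

open FreeGroup

variable {X : Type} {S : XDigraph X}

/-- The dart `f` can follow the dart `d` in an immersed path. -/
def Follows (d f : S.Dart) : Prop := S.dTerm d = S.dInit f ∧ f ≠ S.dRev d

theorem follows_dRev {d f : S.Dart} (h : S.Follows d f) : S.Follows (S.dRev f) (S.dRev d) :=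
  ⟨by simpa using h.1.symm, fun hd => h.2 (by simpa using hd.symm)⟩

open Classical in
theorem card_filter_follows (f : S.Dart) :
    ((Finset.univ.filter fun d => S.Follows d f).card : ℚ) = S.degree (S.dInit f) - 1 := by
  have : (Finset.univ.filter fun d => S.Follows d f) =
      (Finset.univ.filter fun d => S.dTerm d = S.dInit f).erase (S.dRev f) := by
    ext d
    rw [Finset.mem_filter_univ, Finset.mem_erase, Finset.mem_filter_univ]
    exact ⟨fun h => ⟨fun hd => h.2 (by simp [hd]), h.1⟩,
      fun h => ⟨h.2, fun hf => h.1 (by simp [hf])⟩⟩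
  rw [this, Finset.cast_card_erase_of_mem (by simp)]
  congr! 3

open Classical in
theorem card_filter_follows' (d : S.Dart) :
    ((Finset.univ.filter fun f => S.Follows d f).card : ℚ) = S.degree (S.dTerm d) - 1 := by
  rw [← dInit_dRev, ← card_filter_follows]
  congr 1
  refine Finset.card_nbij' S.dRev S.dRev ?_ ?_ ?_ ?_ <;> intro f hf
  · simpa using follows_dRev (by simpa using hf)
  · simpa using follows_dRev (by simpa using hf : S.Follows f (S.dRev d))
  · simp
  · simp

theorem NoLeaf.one_lt_degree (h : S.NoLeaf) (d : S.Dart) : 1 < S.degree (S.dTerm d) := by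
  have h0 : 0 < S.degree (S.dTerm d) := Finset.card_pos.2 ⟨d, by simp⟩
  have h1 := h (S.dTerm d)
  omega

theorem NoLeaf.exists_follows (h : S.NoLeaf) (d : S.Dart) : ∃ f, S.Follows d f := by
  obtain ⟨g, hg, hgd⟩ := Finset.exists_mem_ne (h.one_lt_degree d) d
  exact ⟨S.dRev g, by simpa using (Finset.mem_filter.1 hg).2.symm,
    fun hd => hgd (dRev_injective hd)⟩

open Classical in
/-- The transition weights `1 / (deg - 1)` are doubly stochastic, so that no weight enters a set
of darts closed under `Follows`. -/
theorem NoLeaf.mem_of_follows (h : S.NoLeaf) {R : Set S.Dart}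
    (hR : ∀ d f, d ∈ R → S.Follows d f → f ∈ R) {d f : S.Dart} (hf : f ∈ R)
    (hdf : S.Follows d f) : d ∈ R := by
  let w : S.V → ℚ := fun x => (S.degree x - 1 : ℚ)⁻¹
  have hw : ∀ d : S.Dart, 0 < (S.degree (S.dTerm d) - 1 : ℚ) := fun d => by
    have := h.one_lt_degree d
    rw [sub_pos]
    exact_mod_cast this
  let F : S.Dart → S.Dart → ℚ := fun d f => if S.Follows d f then w (S.dInit f) else 0
  have h1 : ∀ f, ∑ d, F d f = 1 := fun f => by
    have := hw (S.dRev f)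
    rw [dTerm_dRev] at this
    simp only [F, w]
    rw [← Finset.sum_filter, Finset.sum_const, nsmul_eq_mul, card_filter_follows,
      mul_inv_cancel₀ this.ne']
  have h2 : ∀ d, ∑ f, F d f = 1 := fun d => by
    have h3 : ∀ f, F d f = if S.Follows d f then w (S.dTerm d) else 0 := fun f => by
      simp only [F]
      split_ifs with hf
      · rw [hf.1]
      · rfl
    simp only [h3, w]
    rw [← Finset.sum_filter, Finset.sum_const, nsmul_eq_mul, card_filter_follows',
      mul_inv_cancel₀ (hw d).ne']
  have h3 : ∑ d ∈ R.toFinset, ∑ f ∈ R.toFinset, F d f = R.toFinset.card := by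
    rw [Finset.card_eq_sum_ones, Nat.cast_sum]
    refine Finset.sum_congr rfl fun d hd => ?_
    rw [Nat.cast_one, ← h2 d]
    refine Finset.sum_subset (Finset.subset_univ _) fun f _ hf => if_neg fun hdf => hf ?_
    exact Set.mem_toFinset.2 (hR d f (Set.mem_toFinset.1 hd) hdf)
  have h4 : ∑ d, ∑ f ∈ R.toFinset, F d f = R.toFinset.card := by
    rw [Finset.sum_comm, Finset.card_eq_sum_ones, Nat.cast_sum]
    exact Finset.sum_congr rfl fun f _ => by rw [h1, Nat.cast_one]
  have h0 : ∀ d f, 0 ≤ F d f := fun d f => by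
    simp only [F]
    split_ifs with hf
    · rw [← hf.1]; exact inv_nonneg.2 (hw d).le
    · exact le_rfl
  by_contra hd
  rw [← Finset.sum_compl_add_sum R.toFinset, h3, add_eq_right,
    Finset.sum_eq_zero_iff_of_nonneg fun d _ => Finset.sum_nonneg fun f _ => h0 d f] at h4
  have h5 := h4 d (by simpa using hd)
  rw [Finset.sum_eq_zero_iff_of_nonneg fun f _ => h0 d f] at h5
  have h6 := h5 f (Set.mem_toFinset.2 hf)
  simp only [F, if_pos hdf, w, ← hdf.1] at h6
  exact (inv_pos.2 (hw d)).ne' h6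

/-- There is an immersed path starting with `d` and ending with `f`. -/
def Reaches : S.Dart → S.Dart → Prop := Relation.ReflTransGen S.Follows

theorem NoLeaf.reaches_symm (h : S.NoLeaf) {d f : S.Dart} (hdf : S.Reaches d f) :
    S.Reaches f d := by
  induction hdf using Relation.ReflTransGen.head_induction_on with
  | refl => exact Relation.ReflTransGen.refl
  | head hdg _ ih =>
    exact h.mem_of_follows (R := {g | S.Reaches f g})
      (fun g k hg hgk => Relation.ReflTransGen.tail hg hgk) ih hdg

theorem NoLeaf.reaches_of_reaches_dRev (h : S.NoLeaf) (hc : S.Connected) {d : S.Dart}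
    (hd : S.Reaches d (S.dRev d)) (f g : S.Dart) : S.Reaches f g := by
  have hstep : ∀ f g : S.Dart, S.dTerm f = S.dInit g →
      (S.Reaches d f ∧ S.Reaches d (S.dRev f)) → S.Reaches d g ∧ S.Reaches d (S.dRev g) := by
    rintro f g hfg ⟨h1, h2⟩
    by_cases hg : g = S.dRev f
    · rw [hg, dRev_dRev]
      exact ⟨h2, h1⟩
    · have hN : S.Follows f g := ⟨hfg, hg⟩
      exact ⟨h1.tail hN, h2.trans (h.reaches_symm (Relation.ReflTransGen.single (follows_dRev hN)))⟩
  have hwalk : ∀ (p : List S.Dart) (f g : S.Dart), S.IsWalk (S.dTerm f) p (S.dInit g) →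
      (S.Reaches d f ∧ S.Reaches d (S.dRev f)) → S.Reaches d g ∧ S.Reaches d (S.dRev g) := by
    intro p
    induction p with
    | nil => exact fun f g hfg => hstep f g hfg
    | cons k p ih => exact fun f g hfg hf => ih k g hfg.2 (hstep f k hfg.1.symm hf)
  have hall : ∀ g, S.Reaches d g := fun g => by
    obtain ⟨p, hp⟩ := hc.exists_isWalk (S.dTerm d) (S.dInit g)
    exact (hwalk p d g hp ⟨Relation.ReflTransGen.refl, hd⟩).1
  exact (h.reaches_symm (hall f)).trans (hall g)

theorem exists_isWalk_of_transGen {d f : S.Dart} (h : Relation.TransGen S.Follows d f) :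
    ∃ p, S.IsWalk (S.dTerm d) p (S.dTerm f) ∧ FreeGroup.IsReduced (d :: p) ∧
      p.getLast? = some f := by
  have hred : ∀ {d g : S.Dart} {p : List S.Dart}, S.Follows d g → FreeGroup.IsReduced (g :: p) →
      FreeGroup.IsReduced (d :: g :: p) := fun {d g p} hdg hr =>
    isReduced_cons_cons.2 ⟨fun h1 => by
      by_contra h2
      refine hdg.2 (Prod.ext h1.symm ?_)
      simp only [dRev]
      cases hb : g.2 <;> cases hb' : d.2 <;> simp_all, hr⟩
  induction h using Relation.TransGen.head_induction_on with
  | single hdf => exact ⟨[f], ⟨hdf.1.symm, rfl⟩, hred hdf (by simp), rfl⟩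
  | @head d g hdg _ ih =>
    obtain ⟨p, hp, hr, hl⟩ := ih
    refine ⟨g :: p, ⟨hdg.1.symm, hp⟩, hred hdg hr, ?_⟩
    rw [List.getLast?_cons, hl, Option.getD_some]

theorem exists_readsFrom_of_transGen (hF : S.Folded) {d f : S.Dart}
    (h : Relation.TransGen S.Follows d f) :
    ∃ L, S.ReadsFrom (S.dTerm d) L (S.dTerm f) ∧ FreeGroup.IsReduced (S.dLab d :: L) ∧
      L.getLast? = some (S.dLab f) := by
  obtain ⟨p, hp, hr, hl⟩ := exists_isWalk_of_transGen h
  refine ⟨p.map S.dLab, ⟨p, hp, rfl⟩, IsWalk.isReduced_map hF (p := d :: p) ⟨rfl, hp⟩ hr, ?_⟩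
  rw [List.getLast?_map, hl, Option.map_some]

theorem reaches_of_isWalk {d f : S.Dart} {p : List S.Dart} {y : S.V}
    (hp : S.IsWalk (S.dTerm d) p y) (hr : FreeGroup.IsReduced (d :: p))
    (hf : f ∈ d :: p) : S.Reaches d f := by
  induction p generalizing d with
  | nil =>
    obtain rfl : f = d := by simpa using hf
    exact Relation.ReflTransGen.refl
  | cons g p ih =>
    rw [isReduced_cons_cons] at hr
    rcases List.mem_cons.1 hf with rfl | hf
    · exact Relation.ReflTransGen.refl
    refine (ih hp.2 hr.2 hf).head ⟨hp.1.symm, ?_⟩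
    rintro rfl
    simpa [dRev] using hr.1 rfl

end XDigraph

namespace XDigraph

open FreeGroup

variable {X : Type} {S : XDigraph X} {P : S.E → Prop} {p : S.V}

/-- The group of closed walks at `p` along edges satisfying `P`, as a subgroup of the free group
on the edges. -/
def loopGroup (P : S.E → Prop) (p : S.V) : Subgroup (FreeGroup S.E) where
  carrier := {g | ∃ q, S.IsWalk p q p ∧ (∀ d ∈ q, P d.1) ∧ FreeGroup.mk q = g}
  one_mem' := ⟨[], rfl, by simp, rfl⟩
  mul_mem' := by
    rintro _ _ ⟨q, hq, hP, rfl⟩ ⟨r, hr, hP', rfl⟩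
    refine ⟨q ++ r, hq.append hr, fun d hd => ?_, mul_mk.symm⟩
    rcases List.mem_append.1 hd with hd | hd
    exacts [hP d hd, hP' d hd]
  inv_mem' := by
    rintro _ ⟨q, hq, hP, rfl⟩
    refine ⟨invRev q, hq.invRev, fun d hd => ?_, inv_mk.symm⟩
    simp only [invRev, List.mem_reverse, List.mem_map] at hd
    obtain ⟨f, hf, rfl⟩ := hd
    exact hP f hf

theorem mem_map_loopGroup {g : FreeGroup X} : g ∈ (loopGroup P p).map (FreeGroup.map S.lab) ↔
    ∃ q, S.IsWalk p q p ∧ (∀ d ∈ q, P d.1) ∧ FreeGroup.mk (q.map S.dLab) = g := by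
  constructor
  · rintro ⟨_, ⟨q, hq, hP, rfl⟩, rfl⟩
    exact ⟨q, hq, hP, rfl⟩
  · rintro ⟨q, hq, hP, rfl⟩
    exact ⟨_, ⟨q, hq, hP, rfl⟩, rfl⟩

theorem eq_one_of_map_lab_eq_one (hF : S.Folded) {g : FreeGroup S.E} (hg : g ∈ loopGroup P p)
    (h : FreeGroup.map S.lab g = 1) : g = 1 := by
  obtain ⟨q, hq, -, rfl⟩ := hg
  have hr := hq.reduce.isReduced_map hF (FreeGroup.IsReduced.of_reduce_eq FreeGroup.reduce.idem)
  rw [← FreeGroup.reduce.self (L := q)] at h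
  have h0 := FreeGroup.IsReduced.mk_injective hr IsReduced.nil h
  rw [← FreeGroup.reduce.self, List.map_eq_nil_iff.1 h0]
  rfl

open Classical in
/-- The vertices of the component of `p` in the subgraph spanned by the edges satisfying `P`. -/
noncomputable def compV (P : S.E → Prop) (p : S.V) : Finset S.V :=
  Finset.univ.filter fun x => Relation.EqvGen (S.AdjOn P) p x

open Classical in
/-- The edges of the component of `p` in the subgraph spanned by the edges satisfying `P`. -/
noncomputable def compE (P : S.E → Prop) (p : S.V) : Finset S.E :=
  Finset.univ.filter fun e => P e ∧ Relation.EqvGen (S.AdjOn P) p (S.init e)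

theorem mem_compV {x : S.V} : x ∈ compV P p ↔ Relation.EqvGen (S.AdjOn P) p x := by
  simp [compV]

theorem mem_compE {e : S.E} : e ∈ compE P p ↔ P e ∧ S.init e ∈ compV P p := by
  simp [compE, compV]

theorem self_mem_compV : p ∈ compV P p := mem_compV.2 (Relation.EqvGen.refl _)

theorem componentRankOne_iff {e₀ : S.E} :
    ComponentRankOne S e₀ p ↔ (compE (· ≠ e₀) p).card = (compV (· ≠ e₀) p).card := by
  classical
  rw [ComponentRankOne, Nat.card_eq_fintype_card, Nat.card_eq_fintype_card, Fintype.card_subtype,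
    Fintype.card_subtype]
  simp only [compE, compV]

theorem eqvGen_dart (d : S.Dart) (hd : P d.1) :
    Relation.EqvGen (S.AdjOn P) (S.dInit d) (S.dTerm d) :=
  eqvGen_adjOn_iff.2 ⟨[d], ⟨rfl, rfl⟩, by simpa using hd⟩

theorem dTerm_mem_compV {d : S.Dart} (hd : P d.1) (h : S.dInit d ∈ compV P p) :
    S.dTerm d ∈ compV P p :=
  mem_compV.2 ((mem_compV.1 h).trans _ _ _ (eqvGen_dart d hd))

theorem fst_mem_compE {d : S.Dart} (hd : P d.1) (h : S.dInit d ∈ compV P p) :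
    d.1 ∈ compE P p := by
  rcases d with ⟨e, _ | _⟩
  · exact mem_compE.2 ⟨hd, dTerm_mem_compV (d := (e, false)) hd h⟩
  · exact mem_compE.2 ⟨hd, h⟩

theorem exists_dart_of_ssubset {A : Finset S.V} (hp : p ∈ A) (hA : A ⊂ compV P p) :
    ∃ d : S.Dart, P d.1 ∧ S.dInit d ∈ A ∧ S.dTerm d ∉ A := by
  by_contra! hcon
  obtain ⟨x, hx, hxA⟩ := Finset.exists_of_ssubset hA
  obtain ⟨q, hq, hP⟩ := eqvGen_adjOn_iff.1 (mem_compV.1 hx)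
  clear hA hx
  induction q generalizing p with
  | nil => exact hxA (hq ▸ hp)
  | cons d q ih =>
    obtain ⟨rfl, hq⟩ := hq
    exact ih (hcon d (hP d (by simp)) hp) hq fun f hf => hP f (by simp [hf])

/-- The displacement of the edge `e` with respect to the potential `g`. -/
def holonomy (g : S.V → FreeGroup X) (e : S.E) : FreeGroup X :=
  g (S.init e) * FreeGroup.of (S.lab e) * (g (S.term e))⁻¹

/-- A spanning tree of the component of `p` carries a potential. -/
theorem exists_potential (P : S.E → Prop) (p : S.V) : ∃ (g : S.V → FreeGroup X) (F : Finset S.E),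
    g p = 1 ∧ F ⊆ compE P p ∧ F.card + 1 = (compV P p).card ∧ ∀ e ∈ F, holonomy g e = 1 := by
  suffices h : ∀ n, n + 1 ≤ (compV P p).card → ∃ (A : Finset S.V) (g : S.V → FreeGroup X)
      (F : Finset S.E), p ∈ A ∧ A ⊆ compV P p ∧ A.card = n + 1 ∧ g p = 1 ∧ F ⊆ compE P p ∧
      F.card = n ∧ ∀ e ∈ F, S.init e ∈ A ∧ S.term e ∈ A ∧ holonomy g e = 1 by
    have hpos : 0 < (compV P p).card := Finset.card_pos.2 ⟨p, self_mem_compV⟩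
    obtain ⟨A, g, F, -, -, -, hg, hF, hc, h⟩ := h ((compV P p).card - 1) (by omega)
    exact ⟨g, F, hg, hF, by omega, fun e he => (h e he).2.2⟩
  intro n
  induction n with
  | zero =>
    exact fun _ => ⟨{p}, 1, ∅, by simp, by simpa using self_mem_compV, by simp, by simp, by simp,
      by simp, by simp⟩
  | succ n ih =>
    intro hn
    obtain ⟨A, g, F, hpA, hA, hAc, hgp, hF, hFc, h⟩ := ih (by omega)
    have hss : A ⊂ compV P p := hA.ssubset_of_ne (by rintro rfl; omega)
    obtain ⟨d, hPd, hdi, hdt⟩ := exists_dart_of_ssubset hpA hss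
    have hne : ∀ x ∈ A, x ≠ S.dTerm d := by rintro x hx rfl; exact hdt hx
    have hdF : d.1 ∉ F := fun hd => by
      obtain ⟨h1, h2, -⟩ := h _ hd
      rcases d with ⟨e, _ | _⟩
      exacts [hdt h1, hdt h2]
    refine ⟨insert (S.dTerm d) A, Function.update g (S.dTerm d)
      (g (S.dInit d) * FreeGroup.mk [S.dLab d]),
      insert d.1 F, by simp [hpA], ?_, ?_, ?_, ?_, ?_, ?_⟩
    · exact Finset.insert_subset (dTerm_mem_compV hPd (hA hdi)) hA
    · rw [Finset.card_insert_of_notMem hdt, hAc]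
    · rw [Function.update_of_ne (hne p hpA), hgp]
    · exact Finset.insert_subset (fst_mem_compE hPd (hA hdi)) hF
    · rw [Finset.card_insert_of_notMem hdF, hFc]
    · intro e he
      rcases Finset.mem_insert.1 he with rfl | he
      · rcases d with ⟨e, _ | _⟩
        · refine ⟨by simp [dTerm], by simpa [dInit] using Or.inr hdi, ?_⟩
          have hi := hne _ hdi
          simp only [dTerm, dInit, Bool.false_eq_true, if_false, holonomy, dLab] at hi ⊢
          rw [Function.update_self, Function.update_of_ne hi]
          have : (FreeGroup.mk [(S.lab e, false)] : FreeGroup X) = (of (S.lab e))⁻¹ := rfl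
          rw [this]
          group
        · refine ⟨by simpa [dInit] using Or.inr hdi, by simp [dTerm], ?_⟩
          have hi := hne _ hdi
          simp only [dTerm, dInit, if_true, holonomy, dLab] at hi ⊢
          rw [Function.update_self, Function.update_of_ne hi]
          change g (S.init e) * of (S.lab e) * (g (S.init e) * of (S.lab e))⁻¹ = 1
          rw [mul_inv_cancel]
      · obtain ⟨h1, h2, h3⟩ := h e he
        refine ⟨by simp [h1], by simp [h2], ?_⟩
        rw [holonomy, Function.update_of_ne (hne _ h1), Function.update_of_ne (hne _ h2)]
        exact h3

theorem IsWalk.mul_mk_mul_inv_mem {g : S.V → FreeGroup X} {N : Subgroup (FreeGroup X)}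
    (hN : ∀ e ∈ compE P p, holonomy g e ∈ N) {x y : S.V} {q : List S.Dart} (hq : S.IsWalk x q y)
    (hP : ∀ d ∈ q, P d.1) (hx : x ∈ compV P p) :
    g x * FreeGroup.mk (q.map S.dLab) * (g y)⁻¹ ∈ N := by
  induction q generalizing x with
  | nil =>
    obtain rfl := hq
    have : (FreeGroup.mk [] : FreeGroup X) = 1 := rfl
    simp [this]
  | cons d q ih =>
    obtain ⟨rfl, hq⟩ := hq
    have hPd := hP d (by simp)
    have hd : g (S.dInit d) * FreeGroup.mk [S.dLab d] * (g (S.dTerm d))⁻¹ ∈ N := by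
      have he := hN _ (fst_mem_compE hPd hx)
      rcases d with ⟨e, _ | _⟩
      · have : (FreeGroup.mk [(S.lab e, false)] : FreeGroup X) = (of (S.lab e))⁻¹ := rfl
        simpa [holonomy, dInit, dTerm, dLab, this, mul_assoc] using inv_mem he
      · exact he
    have := mul_mem hd (ih hq (fun f hf => hP f (by simp [hf])) (dTerm_mem_compV hPd hx))
    rw [List.map_cons, ← List.singleton_append, ← mul_mk]
    convert this using 1
    group

theorem map_loopGroup_le {g : S.V → FreeGroup X} {N : Subgroup (FreeGroup X)}
    (hN : ∀ e ∈ compE P p, holonomy g e ∈ N) (hg : g p = 1) :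
    (loopGroup P p).map (FreeGroup.map S.lab) ≤ N := by
  intro w hw
  obtain ⟨q, hq, hP, rfl⟩ := mem_map_loopGroup.1 hw
  simpa [hg] using hq.mul_mk_mul_inv_mem hN hP self_mem_compV

theorem map_loopGroup_eq_bot (h : (compE P p).card < (compV P p).card) :
    (loopGroup P p).map (FreeGroup.map S.lab) = ⊥ := by
  obtain ⟨g, F, hg, hF, hc, hh⟩ := exists_potential P p
  refine le_bot_iff.1 (map_loopGroup_le (g := g) (fun e he => ?_) hg)
  rw [← Finset.eq_of_subset_of_card_le hF (by omega)] at he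
  exact hh e he

theorem exists_map_loopGroup_le_zpowers (h : (compE P p).card ≤ (compV P p).card) :
    ∃ c, (loopGroup P p).map (FreeGroup.map S.lab) ≤ Subgroup.zpowers c := by
  classical
  obtain ⟨g, F, hg, hF, hc, hh⟩ := exists_potential P p
  have h1 : (compE P p \ F).card ≤ 1 := by
    rw [Finset.card_sdiff_of_subset hF]
    omega
  have h2 : ∃ c, ∀ e ∈ compE P p \ F, holonomy g e = c := by
    rcases (compE P p \ F).eq_empty_or_nonempty with h0 | ⟨e, he⟩
    · exact ⟨1, by simp [h0]⟩
    · exact ⟨holonomy g e, fun f hf => by rw [Finset.card_le_one.1 h1 f hf e he]⟩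
  obtain ⟨c, hc⟩ := h2
  refine ⟨c, map_loopGroup_le (g := g) (fun e he => ?_) hg⟩
  by_cases heF : e ∈ F
  · rw [hh e heF]
    exact one_mem _
  · rw [hc e (by simp [he, heF])]
    exact Subgroup.mem_zpowers c

/-- The value of the cochain `c` on chains, as a homomorphism from the free group on the edges. -/
def evalCochain (c : S.E → ZMod 2) : FreeGroup S.E →* Multiplicative (ZMod 2) :=
  FreeGroup.lift fun e => Multiplicative.ofAdd (c e)

theorem exists_coboundary {c : S.E → ZMod 2} (hc : ∀ g ∈ loopGroup P p, evalCochain c g = 1) :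
    ∃ f : S.V → ZMod 2, f p = 0 ∧ ∀ e ∈ compE P p, c e = f (S.init e) + f (S.term e) := by
  classical
  have hex : ∀ x, ∃ q, x ∈ compV P p → S.IsWalk p q x ∧ ∀ d ∈ q, P d.1 := fun x => by
    by_cases hx : x ∈ compV P p
    · obtain ⟨q, hq⟩ := eqvGen_adjOn_iff.1 (mem_compV.1 hx)
      exact ⟨q, fun _ => hq⟩
    · exact ⟨[], fun h => absurd h hx⟩
  choose q hq using hex
  have hclosed : ∀ r, S.IsWalk p r p → (∀ d ∈ r, P d.1) →
      (evalCochain c (FreeGroup.mk r)).toAdd = 0 := fun r hr hP => by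
    rw [hc _ ⟨r, hr, hP, rfl⟩]; rfl
  refine ⟨fun x => (evalCochain c (FreeGroup.mk (q x))).toAdd,
    hclosed _ (hq p self_mem_compV).1 (hq p self_mem_compV).2, fun e he => ?_⟩
  have hP := (mem_compE.1 he).1
  have hi := (mem_compE.1 he).2
  have ht : S.term e ∈ compV P p := dTerm_mem_compV (d := (e, true)) hP hi
  have hw : S.IsWalk p (q (S.init e) ++ (e, true) :: invRev (q (S.term e))) p :=
    (hq _ hi).1.append ⟨rfl, (hq _ ht).1.invRev⟩
  have h := hclosed _ hw fun d hd => by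
    simp only [invRev, List.mem_append, List.mem_cons, List.mem_reverse, List.mem_map] at hd
    rcases hd with hd | rfl | ⟨f, hf, rfl⟩
    exacts [(hq _ hi).2 d hd, hP, (hq _ ht).2 f hf]
  have h1 : evalCochain c (FreeGroup.mk [(e, true)]) = Multiplicative.ofAdd (c e) := by
    simp [evalCochain]
  rw [← mul_mk, ← List.singleton_append, ← mul_mk, ← inv_mk, MonoidHom.map_mul, MonoidHom.map_mul,
    MonoidHom.map_inv, h1, toAdd_mul, toAdd_mul, toAdd_inv, toAdd_ofAdd] at h
  rw [← sub_eq_zero, ← h, CharTwo.sub_eq_add, CharTwo.neg_eq]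
  ring

theorem card_compE_le (hF : S.Folded) {c : FreeGroup X}
    (h : (loopGroup P p).map (FreeGroup.map S.lab) ≤ Subgroup.zpowers c) :
    (compE P p).card ≤ (compV P p).card := by
  classical
  obtain ⟨y, hy, hgen⟩ : ∃ y ∈ loopGroup P p, ∀ g ∈ loopGroup P p, g ∈ Subgroup.zpowers y := by
    let f : loopGroup P p →* Subgroup.zpowers c :=
      ((FreeGroup.map S.lab).comp (loopGroup P p).subtype).codRestrict _
        fun g => h ⟨g, g.2, rfl⟩
    have hf : Function.Injective f := (injective_iff_map_eq_one f).2 fun g hg =>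
      Subtype.ext (eq_one_of_map_lab_eq_one hF g.2 (congrArg Subtype.val hg))
    have := isCyclic_of_injective f hf
    obtain ⟨y, hy⟩ := IsCyclic.exists_generator (α := loopGroup P p)
    refine ⟨y, y.2, fun g hg => ?_⟩
    obtain ⟨n, hn⟩ := hy ⟨g, hg⟩
    exact ⟨n, congrArg Subtype.val hn⟩
  let ext (c : compE P p → ZMod 2) : S.E → ZMod 2 := fun e =>
    if he : e ∈ compE P p then c ⟨e, he⟩ else 0
  let extV (f : compV P p → ZMod 2) : S.V → ZMod 2 := fun x =>
    if hx : x ∈ compV P p then f ⟨x, hx⟩ else 0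
  have hzero : ∀ c : S.E → ZMod 2, evalCochain c y = 1 → ∃ f : S.V → ZMod 2, f p = 0 ∧
      ∀ e ∈ compE P p, c e = f (S.init e) + f (S.term e) := fun c hc =>
    exists_coboundary fun g hg => by
      obtain ⟨n, rfl⟩ := hgen g hg
      simp [hc]
  obtain ⟨c₁, hc₁⟩ : ∃ c₁ : S.E → ZMod 2, ∀ c : S.E → ZMod 2, evalCochain c y = 1 ∨
      evalCochain (c - c₁) y = 1 := by
    by_cases hc : ∀ c : S.E → ZMod 2, evalCochain c y = 1
    · exact ⟨0, fun c => Or.inl (hc c)⟩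
    · push Not at hc
      obtain ⟨c₁, hc₁⟩ := hc
      refine ⟨c₁, fun c => or_iff_not_imp_left.2 fun hc => ?_⟩
      have hdiv : evalCochain (c - c₁) = evalCochain c / evalCochain c₁ := by
        ext e
        simp [evalCochain]
      have h2 : ∀ a b : Multiplicative (ZMod 2), a ≠ 1 → b ≠ 1 → a / b = 1 := by decide
      rw [hdiv]
      exact h2 _ _ hc hc₁
  have hsurj : Function.Surjective fun (f : compV P p → ZMod 2) (e : compE P p) =>
      f ⟨p, self_mem_compV⟩ * c₁ e + (extV f (S.init e) + extV f (S.term e)) := by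
    have hext : ∀ (f : S.V → ZMod 2) (e : S.E), e ∈ compE P p →
        extV (fun x => f x) (S.init e) = f (S.init e) ∧
        extV (fun x => f x) (S.term e) = f (S.term e) := fun f e he => by
      have h := mem_compE.1 he
      exact ⟨dif_pos h.2, dif_pos (dTerm_mem_compV (d := (e, true)) h.1 h.2)⟩
    intro c
    have hce : ∀ e : compE P p, ext c e = c e := fun e => dif_pos e.2
    rcases hc₁ (ext c) with hc | hc
    · obtain ⟨f, hf, hfe⟩ := hzero _ hc
      refine ⟨fun x => f x, funext fun e => ?_⟩
      simp only [(hext f e e.2).1, (hext f e e.2).2]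
      rw [hf, zero_mul, zero_add, ← hfe e e.2, hce]
    · obtain ⟨f, hf, hfe⟩ := hzero _ hc
      refine ⟨fun x => f x + 1, funext fun e => ?_⟩
      have := hext (fun x => f x + 1) e e.2
      simp only [this.1, this.2]
      have h1 := hfe e e.2
      rw [Pi.sub_apply, hce] at h1
      rw [hf, zero_add, one_mul, add_add_add_comm, ← h1, CharTwo.add_self_eq_zero]
      ring
  have := Fintype.card_le_of_surjective _ hsurj
  simp only [Fintype.card_fun, ZMod.card, Fintype.card_coe] at this
  exact (Nat.pow_le_pow_iff_right (by norm_num)).1 this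

end XDigraph

namespace XDigraph

open FreeGroup

variable {X : Type} {S : XDigraph X} {ε : S.Dart}

/-- The labels of the closed walks at the initial vertex of `ε` that avoid the edge of `ε`. -/
def side (ε : S.Dart) : Subgroup (FreeGroup X) :=
  (loopGroup (· ≠ ε.1) (S.dInit ε)).map (FreeGroup.map S.lab)

theorem side_le_offLetter (hu : ∀ e, S.lab e = S.lab ε.1 → e = ε.1) :
    side ε ≤ offLetter (S.dLab ε).1 := by
  intro g hg
  obtain ⟨q, -, hq, rfl⟩ := mem_map_loopGroup.1 hg
  refine mk_mem_offLetter fun a ha hav => ?_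
  obtain ⟨d, hd, rfl⟩ := List.mem_map.1 ha
  exact hq d hd (hu _ hav)

theorem mk_mem_side {L : List (X × Bool)} (hL : S.ReadsFrom (S.dInit ε) L (S.dInit ε))
    (hv : ∀ a ∈ L, a.1 ≠ (S.dLab ε).1) : FreeGroup.mk L ∈ side ε := by
  obtain ⟨q, hq, rfl⟩ := hL
  refine mem_map_loopGroup.2 ⟨q, hq, fun d hd hde => ?_, rfl⟩
  exact hv _ (List.mem_map_of_mem hd) (congrArg S.lab hde)

theorem ReadsFrom.eqvGen {x y : S.V} {L : List (X × Bool)} (hL : S.ReadsFrom x L y)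
    (hv : ∀ a ∈ L, a.1 ≠ (S.dLab ε).1) : Relation.EqvGen (S.AdjOn (· ≠ ε.1)) x y := by
  obtain ⟨q, hq, rfl⟩ := hL
  refine eqvGen_adjOn_iff.2 ⟨q, hq, fun d hd hde => ?_⟩
  exact hv _ (List.mem_map_of_mem hd) (congrArg S.lab hde)

theorem eq_or_eq_dRev {d : S.Dart} (h : d.1 = ε.1) : d = ε ∨ d = S.dRev ε := by
  rcases d with ⟨e, b⟩
  rcases ε with ⟨e', b'⟩
  obtain rfl : e = e' := h
  cases b <;> cases b' <;> simp [dRev]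

/-- The edge of `ε` is a cut edge, and it is the only edge with its label. -/
structure IsBridge (ε : S.Dart) : Prop where
  unique : ∀ e, S.lab e = S.lab ε.1 → e = ε.1
  not_eqvGen : ¬ Relation.EqvGen (S.AdjOn (· ≠ ε.1)) (S.dInit ε) (S.dTerm ε)

theorem IsBridge.dRev (h : IsBridge ε) : IsBridge (S.dRev ε) :=
  ⟨h.unique, fun he => by
    rw [dInit_dRev, dTerm_dRev] at he
    exact h.not_eqvGen he.symm⟩

variable [DecidableEq X]

theorem readsFrom_of_mem_side (hF : S.Folded) {g : FreeGroup X} (hg : g ∈ side ε) :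
    S.ReadsFrom (S.dInit ε) g.toWord (S.dInit ε) := by
  obtain ⟨q, hq, -, rfl⟩ := mem_map_loopGroup.1 hg
  exact ReadsFrom.toWord_mk hF ⟨q, hq, rfl⟩

/-- A reduced word read from the initial vertex of a bridge that does not start with the inverse
of the bridge starts with a nontrivial loop followed by the bridge. -/
theorem IsBridge.exists_eq_append (h : IsBridge ε) {L : List (X × Bool)} {y : S.V}
    (hL : S.ReadsFrom (S.dInit ε) L y) (hr : FreeGroup.IsReduced (S.dLab (S.dRev ε) :: L))
    (hv : ∃ a ∈ L, a.1 = (S.dLab ε).1) : ∃ g ∈ side ε, g ≠ 1 ∧ ∃ M,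
      L = g.toWord ++ S.dLab ε :: M ∧ S.ReadsFrom (S.dTerm ε) M y ∧
      FreeGroup.IsReduced (S.dLab ε :: M) := by
  obtain ⟨P, q, M, rfl, hq, hP⟩ : ∃ P q M, L = P ++ q :: M ∧ q.1 = (S.dLab ε).1 ∧
      ∀ a ∈ P, a.1 ≠ (S.dLab ε).1 := by
    obtain ⟨a, ha, hav⟩ := hv
    have hd : L.dropWhile (fun a => a.1 ≠ (S.dLab ε).1) ≠ [] := fun h0 => by
      simpa [hav] using List.dropWhile_eq_nil_iff.1 h0 a ha
    obtain ⟨q, M, hqM⟩ := List.exists_cons_of_ne_nil hd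
    refine ⟨L.takeWhile fun a => a.1 ≠ (S.dLab ε).1, q, M, ?_, ?_, fun a ha => ?_⟩
    · rw [← hqM, List.takeWhile_append_dropWhile]
    · have := List.head_dropWhile_not (fun a : X × Bool => decide (a.1 ≠ (S.dLab ε).1)) hd
      rw [(List.head_eq_iff_head?_eq_some hd).2 (by rw [hqM]; rfl : _ = some q)] at this
      simpa using this
    · simpa using List.mem_takeWhile_imp ha
  obtain ⟨z, hz, hzM⟩ := readsFrom_append.1 hL
  obtain ⟨d, rfl, rfl, hM⟩ := readsFrom_cons.1 hzM
  have hPe := hz.eqvGen hP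
  obtain rfl : d = ε := by
    have h1 : d.1 = ε.1 := h.unique _ hq
    by_contra hne
    have h2 := (eq_or_eq_dRev h1).resolve_left hne
    refine h.not_eqvGen ?_
    rw [h2, dInit_dRev] at hPe
    exact hPe
  have hPr : FreeGroup.IsReduced P := hr.infix ⟨[S.dLab (S.dRev d)], S.dLab d :: M, by simp⟩
  refine ⟨FreeGroup.mk P, mk_mem_side hz hP, fun h1 => ?_, M, ?_, hM, ?_⟩
  · obtain rfl := FreeGroup.IsReduced.mk_injective hPr IsReduced.nil h1
    rw [List.nil_append, isReduced_cons_cons] at hr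
    simpa [dLab, XDigraph.dRev] using hr.1 rfl
  · rw [hPr.toWord_mk]
  · exact hr.infix ⟨S.dLab (S.dRev d) :: P, [], by simp⟩

/-- Crossing a bridge back and forth. -/
theorem IsBridge.exists_eq_append₂ (h : IsBridge ε) {L : List (X × Bool)}
    (hL : S.ReadsFrom (S.dInit ε) L (S.dInit ε))
    (hr : FreeGroup.IsReduced (S.dLab (S.dRev ε) :: L))
    (hv : ∃ a ∈ L, a.1 = (S.dLab ε).1) : ∃ u ∈ side ε, u ≠ 1 ∧ ∃ k ∈ side (S.dRev ε), k ≠ 1 ∧ ∃ M,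
      L = u.toWord ++ S.dLab ε :: (k.toWord ++ S.dLab (S.dRev ε) :: M) ∧
      S.ReadsFrom (S.dInit ε) M (S.dInit ε) ∧
      FreeGroup.IsReduced (S.dLab (S.dRev ε) :: M) := by
  obtain ⟨u, hu, hu1, L', rfl, hL', hr'⟩ := h.exists_eq_append hL hr hv
  have hv' : ∃ a ∈ L', a.1 = (S.dLab ε).1 := by
    by_contra! hcon
    exact h.not_eqvGen (hL'.eqvGen hcon).symm
  obtain ⟨k, hk, hk1, M, rfl, hM, hr''⟩ := h.dRev.exists_eq_append (L := L') (y := S.dInit ε)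
    (by rwa [dInit_dRev]) (by rwa [dRev_dRev]) hv'
  exact ⟨u, hu, hu1, k, hk, hk1, M, rfl, by rwa [dTerm_dRev] at hM, hr''⟩

theorem IsBridge.exists_altWord (h : IsBridge ε) {L : List (X × Bool)}
    (hL : S.ReadsFrom (S.dInit ε) L (S.dInit ε))
    (hr : FreeGroup.IsReduced (S.dLab (S.dRev ε) :: L))
    (hl : L = [] ∨ L.getLast? = some (S.dLab (S.dRev ε))) :
    ∃ B, IsAlt (side ε) (side (S.dRev ε)) B ∧ L = altWord (S.dLab ε) B := by
  induction hn : L.length using Nat.strong_induction_on generalizing L with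
  | _ n ih =>
    rcases hl with rfl | hl
    · exact ⟨[], by simp [IsAlt], rfl⟩
    · obtain ⟨u, hu, hu1, k, hk, hk1, M, rfl, hM, hr'⟩ := h.exists_eq_append₂ hL hr
        ⟨_, List.mem_of_getLast? hl, rfl⟩
      have hlM : M = [] ∨ M.getLast? = some (S.dLab (S.dRev ε)) := by
        rcases List.eq_nil_or_concat' M with rfl | ⟨M, a, rfl⟩
        · exact Or.inl rfl
        · right
          rw [← hl, ← List.cons_append, ← List.append_assoc, ← List.cons_append,
            ← List.append_assoc, List.getLast?_concat, List.getLast?_concat]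
      obtain ⟨B, hB, rfl⟩ := ih M.length (by simp at hn; omega) hM hr' hlM rfl
      refine ⟨(u, k) :: B, ?_, (altWord_cons (u, k)).symm⟩
      intro q hq
      rcases List.mem_cons.1 hq with rfl | hq
      exacts [⟨⟨hu, hu1⟩, hk, hk1⟩, hB q hq]

theorem readsFrom_altWord (hF : S.Folded) {B : List (FreeGroup X × FreeGroup X)}
    (hB : IsAlt (side ε) (side (S.dRev ε)) B) :
    S.ReadsFrom (S.dInit ε) (altWord (S.dLab ε) B) (S.dInit ε) := by
  induction B with
  | nil => exact readsFrom_nil.2 rfl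
  | cons p B ih =>
    obtain ⟨⟨hu, -⟩, hk, -⟩ := hB p (by simp)
    have hk' := readsFrom_of_mem_side hF hk
    rw [dInit_dRev] at hk'
    have h2 := (readsFrom_singleton_rev ε).append (ih fun q hq => hB q (by simp [hq]))
    rw [altWord_cons]
    exact (readsFrom_of_mem_side hF hu).append ((readsFrom_singleton ε).append (hk'.append h2))

theorem IsBridge.exists_mem_side (h : IsBridge ε) (hF : S.Folded) (hnl : S.NoLeaf) :
    (∃ u ∈ side ε, u ≠ 1) ∧ ∃ k ∈ side (S.dRev ε), k ≠ 1 := by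
  obtain ⟨f, hf⟩ := hnl.exists_follows (S.dRev ε)
  have hR := hnl.reaches_symm (Relation.ReflTransGen.single hf)
  obtain ⟨L, hL, hr, hl⟩ := exists_readsFrom_of_transGen hF
    (Relation.TransGen.head' hf hR)
  rw [dTerm_dRev] at hL
  obtain ⟨u, hu, hu1, k, hk, hk1, -⟩ := h.exists_eq_append₂ hL hr
    ⟨_, List.mem_of_getLast? hl, rfl⟩
  exact ⟨⟨u, hu, hu1⟩, k, hk, hk1⟩

theorem IsBridge.isAlternating (h : IsBridge ε) {H : Subgroup (FreeGroup X)} (hS : CRep S H)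
    (h1 : ComponentRankOne S ε.1 (S.dInit ε)) :
    IsAlternating H (S.dLab ε) (side ε) (side (S.dRev ε)) where
  left_le := side_le_offLetter h.unique
  right_le := side_le_offLetter h.dRev.unique
  exists_left := (h.exists_mem_side hS.1 hS.2.2.1).1
  exists_right := (h.exists_mem_side hS.1 hS.2.2.1).2
  le_zpowers := exists_map_loopGroup_le_zpowers (componentRankOne_iff.1 h1).le
  of_conj_mem := by
    rintro w ⟨c, hc⟩
    obtain ⟨L, hL, hwL, -⟩ := exists_isCyclicallyReduced_isConj w
    have hLH : ∃ c, c * FreeGroup.mk L * c⁻¹ ∈ H := by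
      obtain ⟨b, hb⟩ := isConj_iff.1 hwL
      refine ⟨c * b⁻¹, ?_⟩
      rw [← hb]
      convert hc using 1
      group
    obtain ⟨x, hx⟩ := (exists_readsFrom_iff hS hL).2 hLH
    by_cases hv : ∀ a ∈ L, a.1 ≠ (S.dLab ε).1
    · exact Or.inl ⟨_, mk_mem_offLetter hv, hwL⟩
    right
    -- rotating `L` so that it ends with a given letter of the bridge
    have hrot : ∀ δ : S.Dart, IsBridge δ → S.dLab δ ∈ L → ∃ M, L ~r M ++ [S.dLab δ] ∧
        S.ReadsFrom (S.dTerm δ) (M ++ [S.dLab δ]) (S.dTerm δ) ∧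
        FreeGroup.IsReduced (S.dLab δ :: (M ++ [S.dLab δ])) := by
      intro δ hδ hmem
      obtain ⟨L₁, L₂, rfl⟩ := List.append_of_mem hmem
      have hr : L₁ ++ S.dLab δ :: L₂ ~r (L₂ ++ L₁) ++ [S.dLab δ] :=
        by
        rw [List.append_cons]
        simpa using List.isRotated_append (l := L₁ ++ [S.dLab δ]) (l' := L₂)
      refine ⟨L₂ ++ L₁, hr, ?_, ?_⟩
      · obtain ⟨y, hy⟩ := hx.exists_of_isRotated hr
        obtain ⟨z, hz, hzy⟩ := readsFrom_append.1 hy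
        obtain ⟨d, rfl, hd, hdy⟩ := readsFrom_cons.1 hzy
        obtain rfl : d = δ := Prod.ext (hδ.unique _ (congrArg Prod.fst hd)) (congrArg Prod.snd hd :)
        rw [readsFrom_nil] at hdy
        rwa [← hdy] at hy
      · exact (hL.isRotated hr).isReduced_cons (by simp)
    have hmem : S.dLab (S.dRev ε) ∈ L := by
      push Not at hv
      obtain ⟨a, ha, hav⟩ := hv
      by_cases hae : a = S.dLab ε
      · subst hae
        obtain ⟨M, hM, hread, hr⟩ := hrot ε h ha
        obtain ⟨k, -, -, M', hM', -⟩ := h.dRev.exists_eq_append (L := M ++ [S.dLab ε])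
          (y := S.dTerm ε) (by rwa [dInit_dRev]) (by rwa [dRev_dRev]) ⟨S.dLab ε, by simp, rfl⟩
        exact hM.mem_iff.2 (by rw [hM']; simp)
      · have : a = S.dLab (S.dRev ε) :=
          Prod.ext hav (Bool.eq_not_of_ne fun h2 => hae (Prod.ext hav h2))
        rwa [← this]
    obtain ⟨M, hM, hread, hr⟩ := hrot _ h.dRev hmem
    rw [dTerm_dRev] at hread
    obtain ⟨B, hB, hMB⟩ := h.exists_altWord hread hr (Or.inr (by simp))
    refine ⟨B, ?_, hB, hwL.trans ?_⟩
    · rintro rfl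
      simp at hMB
    · rw [← hMB]
      exact isConj_mk_of_isRotated hM
  conj_mem := fun B _ hB => (exists_readsFrom_iff hS
    (hB.isCyclicallyReduced (side_le_offLetter h.unique)
      (side_le_offLetter (ε := S.dRev ε) h.dRev.unique))).1 ⟨_, readsFrom_altWord hS.1 hB⟩

end XDigraph

namespace XDigraph

open FreeGroup

variable {X : Type} {S : XDigraph X}

theorem IsWalk.eqvGen_or (ε : S.Dart) {x y : S.V} {q : List S.Dart} (hq : S.IsWalk x q y) :
    Relation.EqvGen (S.AdjOn (· ≠ ε.1)) x y ∨
      Relation.EqvGen (S.AdjOn (· ≠ ε.1)) x (S.dInit ε) ∨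
      Relation.EqvGen (S.AdjOn (· ≠ ε.1)) x (S.dTerm ε) := by
  induction q generalizing x with
  | nil => exact Or.inl (hq ▸ Relation.EqvGen.refl _)
  | cons d q ih =>
    obtain ⟨rfl, hq⟩ := hq
    by_cases hd : d.1 = ε.1
    · rcases eq_or_eq_dRev hd with rfl | rfl
      · exact Or.inr (Or.inl (Relation.EqvGen.refl _))
      · rw [dInit_dRev]
        exact Or.inr (Or.inr (Relation.EqvGen.refl _))
    · have h := eqvGen_dart (P := (· ≠ ε.1)) d hd
      exact (ih hq).imp (h.trans _ _ _) (Or.imp (h.trans _ _ _) (h.trans _ _ _))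

theorem Connected.eqvGen_or (hc : S.Connected) (ε : S.Dart) (x : S.V) :
    Relation.EqvGen (S.AdjOn (· ≠ ε.1)) x (S.dInit ε) ∨
      Relation.EqvGen (S.AdjOn (· ≠ ε.1)) x (S.dTerm ε) := by
  obtain ⟨q, hq⟩ := hc.exists_isWalk x (S.dInit ε)
  rcases hq.eqvGen_or ε with h | h
  exacts [Or.inl h, h]

theorem Connected.componentsCount_eq_two_iff (hc : S.Connected) (ε : S.Dart) :
    componentsCount S (· ≠ ε.1) (fun _ => True) = 2 ↔
      ¬ Relation.EqvGen (S.AdjOn (· ≠ ε.1)) (S.dInit ε) (S.dTerm ε) := by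
  let s : Setoid {x : S.V // True} := Setoid.comap (Subtype.val : {x : S.V // True} → S.V)
    (Relation.EqvGen.setoid (S.AdjOn (· ≠ ε.1)))
  let π : S.V → Quotient s := fun x => Quotient.mk s ⟨x, trivial⟩
  have hπ : ∀ x y, π x = π y ↔ Relation.EqvGen (S.AdjOn (· ≠ ε.1)) x y := fun x y =>
    Quotient.eq (r := s)
  have hcov : ∀ a, a = π (S.dInit ε) ∨ a = π (S.dTerm ε) := by
    intro a
    induction a using Quotient.inductionOn with
    | h a => exact (hc.eqvGen_or ε a.1).imp (hπ _ _).2 (hπ _ _).2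
  change Nat.card (Quotient s) = 2 ↔ _
  rw [← hπ]
  constructor
  · intro h heq
    have : Subsingleton (Quotient s) := ⟨fun a b => by
      rcases hcov a with rfl | rfl <;> rcases hcov b with rfl | rfl <;> simp [heq]⟩
    have := Finite.card_le_one_iff_subsingleton (α := Quotient s) |>.2 this
    omega
  · intro h
    refine Nat.card_eq_two_iff.2 ⟨_, _, h, Set.eq_univ_of_forall fun a => ?_⟩
    simpa using hcov a

theorem componentRankOne_congr {e₀ : S.E} {x y : S.V} (h : ComponentRankOne S e₀ x)
    (hxy : Relation.EqvGen (S.AdjOn (· ≠ e₀)) x y) : ComponentRankOne S e₀ y := by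
  have : ∀ z, Relation.EqvGen (S.AdjOn (· ≠ e₀)) x z ↔ Relation.EqvGen (S.AdjOn (· ≠ e₀)) y z :=
    fun z => ⟨(hxy.symm).trans _ _ _, hxy.trans _ _ _⟩
  simpa only [ComponentRankOne, this] using h

theorem IsBridge.propertyL {ε : S.Dart} (h : IsBridge ε) (hc : S.Connected)
    (h1 : ComponentRankOne S ε.1 (S.dInit ε)) : PropertyL S (S.lab ε.1) :=
  ⟨ε.1, rfl, h.unique, (hc.componentsCount_eq_two_iff ε).2 h.not_eqvGen, _, h1⟩

theorem exists_isBridge_of_propertyL (hc : S.Connected) {v : X} (hL : PropertyL S v) :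
    ∃ ε : S.Dart, IsBridge ε ∧ S.lab ε.1 = v ∧ ComponentRankOne S ε.1 (S.dInit ε) := by
  obtain ⟨e, rfl, hu, h2, u, h1⟩ := hL
  have hb : IsBridge ((e, true) : S.Dart) := ⟨hu, (hc.componentsCount_eq_two_iff (e, true)).1 h2⟩
  rcases hc.eqvGen_or (e, true) u with h | h
  · exact ⟨(e, true), hb, rfl, componentRankOne_congr h1 h⟩
  · exact ⟨S.dRev (e, true), hb.dRev, rfl, componentRankOne_congr h1 h⟩

end XDigraph

/-- A transitive group of permutations of a finite set, all of whose elements have a fixed point,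
acts on a point. -/
theorem subsingleton_of_forall_exists_fixedPoint {G α : Type} [Group G] [Finite G] [MulAction G α]
    [MulAction.IsPretransitive G α] [Finite α] (h : ∀ g : G, ∃ a : α, g • a = a) :
    Subsingleton α := by
  classical
  have := Fintype.ofFinite G
  have := Fintype.ofFinite α
  have := Fintype.ofFinite (Quotient (MulAction.orbitRel G α))
  have hΩ : Fintype.card (Quotient (MulAction.orbitRel G α)) ≤ 1 :=
    Fintype.card_le_one_iff_subsingleton.2
      ((MulAction.pretransitive_iff_subsingleton_quotient G α).1 inferInstance)
  have hsum := MulAction.sum_card_fixedBy_eq_card_orbits_mul_card_group G α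
  have hpos : ∀ g : G, 1 ≤ Fintype.card (MulAction.fixedBy α g) := fun g => by
    obtain ⟨a, ha⟩ := h g
    exact Fintype.card_pos_iff.2 ⟨⟨a, ha⟩⟩
  have hone : ∀ g ∈ (Finset.univ : Finset G), 1 = Fintype.card (MulAction.fixedBy α g) := by
    rw [← Finset.sum_eq_sum_iff_of_le fun g _ => hpos g]
    refine le_antisymm (Finset.sum_le_sum fun g _ => hpos g) ?_
    rw [hsum]
    simpa using Nat.mul_le_mul_right (Fintype.card G) hΩ
  refine ⟨fun a b => ?_⟩
  have := Fintype.card_le_one_iff.1 (hone 1 (Finset.mem_univ _)).ge ⟨a, one_smul G a⟩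
    ⟨b, one_smul G b⟩
  exact congrArg Subtype.val this

namespace XDigraph

open FreeGroup

variable {X : Type} [DecidableEq X] {S : XDigraph X} {H : Subgroup (FreeGroup X)} {l : X × Bool}
  {U K : Subgroup (FreeGroup X)}

theorem exists_readsFrom_altWord (h : IsAlternating H l U K) (hS : CRep S H)
    {B : List (FreeGroup X × FreeGroup X)} (hB : IsAlt U K B) :
    ∃ x, S.ReadsFrom x (altWord l B) x := by
  rcases eq_or_ne B [] with rfl | h0
  · obtain ⟨x⟩ := hS.2.1.1
    exact ⟨x, readsFrom_nil.2 rfl⟩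
  · exact (exists_readsFrom_iff hS (hB.isCyclicallyReduced h.left_le h.right_le)).2
      (h.conj_mem B h0 hB)

theorem ReadsFrom.exists_eq_altWord (h : IsAlternating H l U K) (hS : CRep S H) {x : S.V}
    {L : List (X × Bool)} (hL : S.ReadsFrom x L x) (hc : IsCyclicallyReduced L)
    (hl : L.getLast? = some (l.1, !l.2)) : ∃ B, IsAlt U K B ∧ L = altWord l B := by
  rcases h.of_conj_mem _ ((exists_readsFrom_iff hS hc).1 ⟨x, hL⟩) with
    ⟨n, hn, hLn⟩ | ⟨B, -, hB, hLB⟩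
  · obtain ⟨M, hM, hnM, hmem⟩ := exists_isCyclicallyReduced_isConj n
    have hr := hc.isRotated_of_isConj hM (hLn.trans hnM)
    exact absurd rfl (mem_offLetter_iff.1 hn (l.1, !l.2)
      (hmem _ (hr.mem_iff.1 (List.mem_of_getLast? hl))))
  · exact exists_altWord_of_isRotated h.left_le h.right_le hB
      (hc.isRotated_of_isConj (hB.isCyclicallyReduced h.left_le h.right_le) hLB) hl

/-- Some vertex reads all alternating words: one at which an alternating word readable from a
minimal number of vertices ends. -/
theorem exists_forall_readsFrom_altWord (h : IsAlternating H l U K) (hS : CRep S H) :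
    ∃ x : S.V, ∀ B, IsAlt U K B → ∃ y, S.ReadsFrom x (altWord l B) y := by
  classical
  let D : List (FreeGroup X × FreeGroup X) → Finset S.V := fun B =>
    Finset.univ.filter fun x => ∃ y, S.ReadsFrom x (altWord l B) y
  obtain ⟨B₀, hB₀, hmin⟩ := (measure fun B => (D B).card).wf.has_min {B | IsAlt U K B}
    ⟨[], by simp [IsAlt]⟩
  obtain ⟨x, hx⟩ := exists_readsFrom_altWord h hS hB₀
  refine ⟨x, fun B hB => ?_⟩
  have hsub : D (B₀ ++ B) ⊆ D B₀ := fun z hz => by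
    obtain ⟨y, hy⟩ := (Finset.mem_filter.1 hz).2
    rw [altWord_append] at hy
    obtain ⟨w, hw, -⟩ := readsFrom_append.1 hy
    exact Finset.mem_filter.2 ⟨Finset.mem_univ _, w, hw⟩
  have heq := Finset.eq_of_subset_of_card_le hsub (not_lt.1 (hmin _ (hB₀.append hB)))
  have hxD : x ∈ D (B₀ ++ B) := heq ▸ Finset.mem_filter.2 ⟨Finset.mem_univ _, x, hx⟩
  obtain ⟨y, hy⟩ := (Finset.mem_filter.1 hxD).2
  rw [altWord_append] at hy
  obtain ⟨w, hw, hy⟩ := readsFrom_append.1 hy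
  obtain rfl := hx.right_unique hS.1 hw
  exact ⟨y, hy⟩

theorem readsFrom_altWord_singleton {u k : FreeGroup X} {x y : S.V} :
    S.ReadsFrom x (altWord l [(u, k)]) y ↔ ∃ d f : S.Dart, S.dLab d = l ∧ S.dLab f = l ∧
      S.ReadsFrom x u.toWord (S.dInit d) ∧ S.ReadsFrom (S.dTerm d) k.toWord (S.dTerm f) ∧
        S.dInit f = y := by
  rw [altWord_cons, altWord_nil]
  constructor
  · intro hr
    obtain ⟨_, h1, hr⟩ := readsFrom_append.1 hr
    obtain ⟨d, rfl, hd, hr⟩ := readsFrom_cons.1 hr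
    obtain ⟨_, h2, hr⟩ := readsFrom_append.1 hr
    obtain ⟨f, rfl, hf, hy⟩ := readsFrom_cons.1 hr
    obtain rfl := readsFrom_nil.1 hy
    refine ⟨d, S.dRev f, hd, ?_, h1, by simpa using h2, by simp⟩
    simpa [dLab, dRev, Prod.ext_iff, Bool.eq_not] using hf
  · rintro ⟨d, f, rfl, hf, h1, h2, rfl⟩
    refine h1.append (readsFrom_cons.2 ⟨d, rfl, rfl, h2.append ?_⟩)
    rw [← hf]
    exact readsFrom_singleton_rev f

theorem exists_reaches_dRev (h : IsAlternating H l U K) (hS : CRep S H) :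
    ∃ d : S.Dart, S.dLab d = l ∧ S.Reaches d (S.dRev d) := by
  obtain ⟨x, hx⟩ := exists_forall_readsFrom_altWord h hS
  obtain ⟨u, hu, hu1⟩ := h.exists_left
  obtain ⟨k, hk, hk1⟩ := h.exists_right
  have hinj := injective_pow_iff_not_isOfFinOrder.2 (not_isOfFinOrder_of_isMulTorsionFree hk1)
  have hpow : ∀ n, k ^ (n + 1) ≠ 1 := fun n hn => by
    simpa using hinj (hn.trans (pow_zero k).symm)
  have hex : ∀ n : ℕ, ∃ d f : S.Dart, S.dLab d = l ∧ S.ReadsFrom x u.toWord (S.dInit d) ∧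
      S.ReadsFrom (S.dTerm d) (k ^ (n + 1)).toWord (S.dTerm f) := fun n => by
    obtain ⟨y, hy⟩ := hx [(u, k ^ (n + 1))] (isAlt_singleton hu hu1 (pow_mem hk _) (hpow n))
    obtain ⟨d, f, hd, -, h1, h2, -⟩ := readsFrom_altWord_singleton.1 hy
    exact ⟨d, f, hd, h1, h2⟩
  choose d f hd h1 h2 using hex
  have hdd : ∀ n, d n = d 0 := fun n =>
    hS.1.dart_ext ((h1 n).right_unique hS.1 (h1 0)) ((hd n).trans (hd 0).symm)
  obtain ⟨i, j, hij, hf⟩ := Finite.exists_ne_map_eq_of_infinite f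
  have hloop : S.ReadsFrom (S.dTerm (d 0)) (k ^ (i + 1) * (k ^ (j + 1))⁻¹).toWord
      (S.dTerm (d 0)) := by
    refine ReadsFrom.toWord_mul hS.1 (hdd i ▸ h2 i) ?_
    rw [hf]
    exact (hdd j ▸ h2 j).toWord_inv
  have hne : k ^ (i + 1) * (k ^ (j + 1))⁻¹ ≠ 1 := fun he => hij (by
    simpa using hinj (mul_inv_eq_one.1 he))
  have hoff := mem_offLetter_iff.1 (h.right_le (mul_mem (pow_mem hk (i + 1))
    (inv_mem (pow_mem hk (j + 1)))))
  have hred := isReduced_toWord.cons_append_cons (p := l) (q := (l.1, !l.2)) (R := [])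
    (toWord_ne_nil hne) hoff hoff (by simp)
  obtain ⟨p, hp, hpl⟩ := hloop
  refine ⟨d 0, hd 0, reaches_of_isWalk (hp.append (y := S.dTerm (d 0)) (q := [S.dRev (d 0)])
    ⟨by simp, rfl⟩) ?_ (by simp)⟩
  have hlab : (d 0 :: (p ++ [S.dRev (d 0)])).map S.dLab =
      l :: ((k ^ (i + 1) * (k ^ (j + 1))⁻¹).toWord ++ [(l.1, !l.2)]) := by
    simp [hpl, ← hd 0, dLab, dRev]
  rw [← hlab] at hred
  exact List.IsChain.imp (fun a b hab he => hab (congrArg S.lab he)) ((List.isChain_map _).1 hred)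

theorem exists_readsFrom_dInit (h : IsAlternating H l U K) (hS : CRep S H) {d f : S.Dart}
    (hf : S.dLab f = l) (hd : S.dLab d = l) : ∃ M, S.ReadsFrom (S.dInit d) M (S.dInit f) ∧
      FreeGroup.IsReduced ((l.1, !l.2) :: M) ∧ M.getLast? = some (l.1, !l.2) := by
  obtain ⟨g, -, hg⟩ := exists_reaches_dRev h hS
  have hR := hS.2.2.1.reaches_of_reaches_dRev hS.2.1 hg
  obtain ⟨e, he⟩ := hS.2.2.1.exists_follows (S.dRev d)
  obtain ⟨M, hM, hr, hl⟩ := exists_readsFrom_of_transGen hS.1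
    (Relation.TransGen.head' he (hR e (S.dRev f)))
  rw [dTerm_dRev, dTerm_dRev] at hM
  subst hf
  refine ⟨M, hM, ?_, hl⟩
  rwa [← hd]

/-- A reduced word read from the initial vertex of an `l`-dart, starting and ending right after
`l⁻¹`, is an alternating word. -/
theorem ReadsFrom.exists_eq_altWord_of_isReduced_cons (h : IsAlternating H l U K) (hS : CRep S H)
    {d : S.Dart} (hd : S.dLab d = l) {M : List (X × Bool)} {y : S.V}
    (hM : S.ReadsFrom (S.dInit d) M y) (hr : FreeGroup.IsReduced ((l.1, !l.2) :: M))
    (hl : M.getLast? = some (l.1, !l.2)) : ∃ B, IsAlt U K B ∧ M = altWord l B := by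
  have hjoin : ∀ {L L' : List (X × Bool)}, FreeGroup.IsReduced ((l.1, !l.2) :: L) →
      L.getLast? = some (l.1, !l.2) → FreeGroup.IsReduced ((l.1, !l.2) :: L') →
      FreeGroup.IsReduced ((l.1, !l.2) :: (L ++ L')) := fun {L L'} h1 h2 h3 => by
    obtain ⟨L, rfl⟩ := List.getLast?_eq_some_iff.1 h2
    have := List.IsChain.append_overlap (l₁ := (l.1, !l.2) :: L) (l₂ := [(l.1, !l.2)]) h1 h3
      (by simp)
    rwa [List.append_assoc, List.cons_append] at this ⊢
  obtain ⟨f, hf, rfl⟩ := hM.exists_dart_of_getLast? hl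
  obtain ⟨M', hM', hr', hl'⟩ := exists_readsFrom_dInit h hS hd hf
  have hlast : (M ++ M').getLast? = some (l.1, !l.2) := by
    rw [List.getLast?_append, hl', Option.some_or]
  have hred := hjoin hr hl hr'
  obtain ⟨B, hB, heq⟩ := (hM.append hM').exists_eq_altWord h hS
    (IsReduced.isCyclicallyReduced_of_append_self
      (List.IsChain.of_cons (hjoin hred hlast hred))) hlast
  obtain ⟨B₁, B₂, rfl, rfl, -⟩ := altWord_eq_append h.left_le h.right_le hB heq.symm hl
  exact ⟨B₁, fun p hp => hB p (by simp [hp]), rfl⟩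

theorem exists_readsFrom_altWord_dInit (h : IsAlternating H l U K) (hS : CRep S H) {d f : S.Dart}
    (hd : S.dLab d = l) (hf : S.dLab f = l) :
    ∃ B, IsAlt U K B ∧ S.ReadsFrom (S.dInit d) (altWord l B) (S.dInit f) := by
  obtain ⟨M, hM, hr, hl⟩ := exists_readsFrom_dInit h hS hf hd
  obtain ⟨B, hB, rfl⟩ := hM.exists_eq_altWord_of_isReduced_cons h hS hd hr hl
  exact ⟨B, hB, hM⟩

theorem ReadsFrom.exists_dart_of_altWord {B : List (FreeGroup X × FreeGroup X)} {x y : S.V}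
    (hr : S.ReadsFrom x (altWord l B) y) (hx : ∃ d : S.Dart, S.dLab d = l ∧ S.dInit d = x) :
    ∃ d : S.Dart, S.dLab d = l ∧ S.dInit d = y := by
  rcases eq_or_ne B [] with rfl | h0
  · obtain rfl := readsFrom_nil.1 hr
    exact hx
  · exact hr.exists_dart_of_getLast? (getLast?_altWord h0)

theorem exists_readsFrom_altWord_of_dart (h : IsAlternating H l U K) (hS : CRep S H) {d : S.Dart}
    (hd : S.dLab d = l) {B : List (FreeGroup X × FreeGroup X)} (hB : IsAlt U K B) :
    ∃ y, S.ReadsFrom (S.dInit d) (altWord l B) y := by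
  obtain ⟨x, hx⟩ := exists_forall_readsFrom_altWord h hS
  obtain ⟨u, hu, hu1⟩ := h.exists_left
  obtain ⟨k, hk, hk1⟩ := h.exists_right
  have hB₀ : IsAlt U K [(u, k)] := isAlt_singleton hu hu1 hk hk1
  obtain ⟨y, hy⟩ := hx _ hB₀
  obtain ⟨-, f, -, hf, -, -, rfl⟩ := readsFrom_altWord_singleton.1 hy
  obtain ⟨C, hC, hfd⟩ := exists_readsFrom_altWord_dInit h hS hf hd
  obtain ⟨z, hz⟩ := hx _ ((hB₀.append hC).append hB)
  rw [altWord_append, altWord_append] at hz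
  obtain ⟨w, hw, hz⟩ := readsFrom_append.1 hz
  obtain rfl := hw.right_unique hS.1 (hy.append hfd)
  exact ⟨z, hz⟩

/-- The permutations of the initial vertices of the `l`-darts induced by reading alternating
words. -/
def altPerm (S : XDigraph X) (l : X × Bool) (U K : Subgroup (FreeGroup X)) :
    Subgroup (Equiv.Perm {x : S.V // ∃ d : S.Dart, S.dLab d = l ∧ S.dInit d = x}) :=
  let M : Submonoid (Equiv.Perm {x : S.V // ∃ d : S.Dart, S.dLab d = l ∧ S.dInit d = x}) :=
    { carrier := {σ | ∃ B, IsAlt U K B ∧ ∀ x, S.ReadsFrom x.1 (altWord l B) (σ x).1}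
      one_mem' := ⟨[], by simp [IsAlt], fun x => readsFrom_nil.2 rfl⟩
      mul_mem' := by
        rintro σ τ ⟨B, hB, hσ⟩ ⟨C, hC, hτ⟩
        refine ⟨C ++ B, hC.append hB, fun x => ?_⟩
        rw [altWord_append]
        exact (hτ x).append (hσ (τ x)) }
  { M with
    inv_mem' := by
      intro σ hσ
      have : σ⁻¹ = σ ^ (orderOf σ - 1) := by
        rw [inv_eq_iff_mul_eq_one, ← pow_succ', Nat.sub_add_cancel (orderOf_pos σ),
          pow_orderOf_eq_one]
      change σ⁻¹ ∈ M
      rw [this]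
      exact pow_mem (show σ ∈ M from hσ) _ }

theorem exists_mem_altPerm (h : IsAlternating H l U K) (hS : CRep S H)
    {B : List (FreeGroup X × FreeGroup X)} (hB : IsAlt U K B) :
    ∃ σ ∈ altPerm S l U K, ∀ x, S.ReadsFrom x.1 (altWord l B) (σ x).1 := by
  have hex : ∀ x : {x : S.V // ∃ d : S.Dart, S.dLab d = l ∧ S.dInit d = x},
      ∃ y : {x : S.V // ∃ d : S.Dart, S.dLab d = l ∧ S.dInit d = x},
        S.ReadsFrom x.1 (altWord l B) y.1 := by
    rintro ⟨_, d, hd, rfl⟩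
    obtain ⟨y, hy⟩ := exists_readsFrom_altWord_of_dart h hS hd hB
    exact ⟨⟨y, hy.exists_dart_of_altWord ⟨d, hd, rfl⟩⟩, hy⟩
  choose σ hσ using hex
  have hinj : Function.Injective σ := fun x y hxy =>
    Subtype.ext ((hσ x).left_unique hS.1 (hxy ▸ hσ y))
  exact ⟨Equiv.ofBijective σ (Finite.injective_iff_bijective.1 hinj), ⟨B, hB, hσ⟩, hσ⟩

theorem exists_unique_dart (h : IsAlternating H l U K) (hS : CRep S H) :
    ∃ ε : S.Dart, S.dLab ε = l ∧ ∀ d : S.Dart, S.dLab d = l → d = ε := by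
  obtain ⟨ε, hε, -⟩ := exists_reaches_dRev h hS
  refine ⟨ε, hε, fun d hd => ?_⟩
  have hfix : ∀ σ : altPerm S l U K,
      ∃ x : {x : S.V // ∃ d : S.Dart, S.dLab d = l ∧ S.dInit d = x}, σ • x = x := by
    rintro ⟨σ, B, hB, hσ⟩
    rcases eq_or_ne B [] with rfl | h0
    · exact ⟨⟨_, ε, hε, rfl⟩, Subtype.ext (readsFrom_nil.1 (hσ _)).symm⟩
    · obtain ⟨x, hx⟩ := exists_readsFrom_altWord h hS hB
      exact ⟨⟨x, hx.exists_dart_of_getLast? (getLast?_altWord h0)⟩,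
        Subtype.ext ((hσ _).right_unique hS.1 hx)⟩
  have htrans : MulAction.IsPretransitive (altPerm S l U K)
      {x : S.V // ∃ d : S.Dart, S.dLab d = l ∧ S.dInit d = x} := by
    refine ⟨?_⟩
    rintro ⟨_, e, he, rfl⟩ ⟨_, f, hf, rfl⟩
    obtain ⟨B, hB, hr⟩ := exists_readsFrom_altWord_dInit h hS he hf
    obtain ⟨σ, hσ, hσr⟩ := exists_mem_altPerm h hS hB
    exact ⟨⟨σ, hσ⟩, Subtype.ext ((hσr _).right_unique hS.1 hr)⟩
  have hsub := subsingleton_of_forall_exists_fixedPoint hfix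
  have heq : (⟨_, d, hd, rfl⟩ : {x : S.V // ∃ d : S.Dart, S.dLab d = l ∧ S.dInit d = x}) =
      ⟨_, ε, hε, rfl⟩ := hsub.elim _ _
  exact hS.1.dart_ext (congrArg Subtype.val heq) (hd.trans hε.symm)

theorem isBridge_of_unique_dart {ε : S.Dart} (h : IsAlternating H (S.dLab ε) U K) (hS : CRep S H)
    (hu : ∀ d : S.Dart, S.dLab d = S.dLab ε → d = ε) : IsBridge ε where
  unique e he := congrArg Prod.fst (hu (e, ε.2) (Prod.ext he rfl))
  not_eqvGen hE := by
    obtain ⟨p, hp, hpε⟩ := eqvGen_adjOn_iff.1 hE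
    have hread := ReadsFrom.toWord_mk hS.1 ⟨p, hp, rfl⟩
    have hoff := mem_offLetter_iff.1 (mk_mem_offLetter (v := (S.dLab ε).1) (L := p.map S.dLab) (by
      intro a ha hav
      obtain ⟨d, hd, rfl⟩ := List.mem_map.1 ha
      have hdε : ((d.1, ε.2) : S.Dart) = ε := hu _ (Prod.ext hav rfl)
      exact hpε d hd (Prod.ext_iff.1 hdε).1))
    generalize FreeGroup.mk (p.map S.dLab) = g at hread hoff
    have hred : FreeGroup.IsReduced
        (((S.dLab ε).1, !(S.dLab ε).2) :: (g.toWord ++ [((S.dLab ε).1, !(S.dLab ε).2)])) := by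
      rcases eq_or_ne g 1 with rfl | hg
      · simp
      · exact isReduced_toWord.cons_append_cons (toWord_ne_nil hg) hoff hoff (by simp)
    obtain ⟨B, -, hB⟩ := ReadsFrom.exists_eq_altWord_of_isReduced_cons h hS rfl
      (hread.append (readsFrom_singleton_rev ε)) hred (by simp)
    have hmem : S.dLab ε ∈ g.toWord ++ [((S.dLab ε).1, !(S.dLab ε).2)] := by
      rw [hB]
      exact mem_altWord (by rintro rfl; simp at hB)
    rcases List.mem_append.1 hmem with hmem | hmem
    · exact hoff _ hmem rfl
    · simpa using congrArg Prod.snd (List.mem_singleton.1 hmem)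

theorem readsFrom_toWord {ε : S.Dart} (h : IsAlternating H (S.dLab ε) U K) (hS : CRep S H)
    (hu : ∀ d : S.Dart, S.dLab d = S.dLab ε → d = ε) {u k : FreeGroup X} (hU : u ∈ U) (hu1 : u ≠ 1)
    (hK : k ∈ K) (hk1 : k ≠ 1) : S.ReadsFrom (S.dInit ε) u.toWord (S.dInit ε) ∧
      S.ReadsFrom (S.dTerm ε) k.toWord (S.dTerm ε) := by
  obtain ⟨x, hx⟩ := exists_readsFrom_altWord h hS (B := [(u, k)]) (isAlt_singleton hU hu1 hK hk1)
  obtain ⟨d, f, hd, hf, h1, h2, rfl⟩ := readsFrom_altWord_singleton.1 hx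
  obtain rfl := hu d hd
  obtain rfl := hu f hf
  exact ⟨h1, h2⟩

theorem side_le {ε : S.Dart} (h : IsAlternating H (S.dLab ε) U K) (hS : CRep S H)
    (hu : ∀ d : S.Dart, S.dLab d = S.dLab ε → d = ε) : side ε ≤ U := by
  intro g hg
  rcases eq_or_ne g 1 with rfl | hg1
  · exact one_mem _
  obtain ⟨u, hU, hu1⟩ := h.exists_left
  obtain ⟨k, hK, hk1⟩ := h.exists_right
  have hle := side_le_offLetter (isBridge_of_unique_dart h hS hu).unique
  have halt : IsAlt (side ε) K [(g, k)] := isAlt_singleton hg hg1 hK hk1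
  have hread : S.ReadsFrom (S.dInit ε) (altWord (S.dLab ε) [(g, k)]) (S.dInit ε) :=
    readsFrom_altWord_singleton.2 ⟨ε, ε, rfl, rfl, readsFrom_of_mem_side hS.1 hg,
      (readsFrom_toWord h hS hu hU hu1 hK hk1).2, rfl⟩
  obtain ⟨B, hB, heq⟩ := hread.exists_eq_altWord_of_isReduced_cons h hS rfl
    (halt.isReduced_cons hle h.right_le) (getLast?_altWord (by simp))
  cases B with
  | nil => simp [altWord_cons] at heq
  | cons p B =>
    rw [altWord_cons, altWord_cons, altWord_nil, List.append_cons_inj_of_notMem] at heq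
    · rw [show g = p.1 from toWord_injective heq.1]
      exact (hB p (by simp)).1.1
    · exact fun hmem => mem_offLetter_iff.1 (hle hg) _ hmem rfl
    · intro hmem
      rcases List.mem_append.1 hmem with hmem | hmem
      · exact mem_offLetter_iff.1 (h.right_le hK) _ hmem rfl
      · simpa using congrArg Prod.snd (List.mem_singleton.1 hmem)

theorem exists_isBridge_of_isAlternating (h : IsAlternating H l U K) (hS : CRep S H) :
    ∃ ε : S.Dart, S.dLab ε = l ∧ IsBridge ε ∧ ComponentRankOne S ε.1 (S.dInit ε) := by
  obtain ⟨ε, rfl, hu⟩ := exists_unique_dart h hS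
  refine ⟨ε, rfl, isBridge_of_unique_dart h hS hu, componentRankOne_iff.2 (le_antisymm ?_ ?_)⟩
  · obtain ⟨c, hc⟩ := h.le_zpowers
    exact card_compE_le hS.1 ((side_le h hS hu).trans hc)
  · obtain ⟨u, hU, hu1⟩ := h.exists_left
    obtain ⟨k, hK, hk1⟩ := h.exists_right
    by_contra! hlt
    have hmem := mk_mem_side (readsFrom_toWord h hS hu hU hu1 hK hk1).1
      (mem_offLetter_iff.1 (h.left_le hU))
    rw [mk_toWord, side, map_loopGroup_eq_bot hlt] at hmem
    exact hu1 (Subgroup.mem_bot.1 hmem)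

end XDigraph

/-- if `S` satisfies Property (L) with letter `v` and `φ = (C, m)` is a
reducing type II Whitehead automorphism with `m ∉ {v, v⁻¹}`, then `φ(S)` has a unique
`v`-edge, that edge is a cut edge, and `φ(S)` satisfies Property (L). -/
theorem propertyL_preserved_by_reducing_whitehead
    {X : Type} [DecidableEq X] (S S' : XDigraph X) (H : Subgroup (FreeGroup X)) (v : X)
    (phi : FreeGroup X ≃* FreeGroup X) (C : Finset (X × Bool)) (m : X × Bool)
    (hS : CRep S H) (hL : PropertyL S v)
    (hphi : IsWhiteheadII phi C m) (hm : m.1 ≠ v)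
    (hS' : CRep S' (H.map phi.toMonoidHom))
    (hred : Fintype.card S'.E < Fintype.card S.E) :
    (∃ e0 : S'.E, S'.lab e0 = v ∧ (∀ e : S'.E, S'.lab e = v → e = e0) ∧
        ¬ Relation.EqvGen (S'.AdjOn (· ≠ e0)) (S'.init e0) (S'.term e0)) ∧
      PropertyL S' v := by
  obtain ⟨ε, hb, rfl, h1⟩ := XDigraph.exists_isBridge_of_propertyL hS.2.1 hL
  obtain ⟨hoff, hlet⟩ := hphi.map_offLetter hm
  obtain ⟨s, hs, t, ht, hl⟩ := hlet ε.2
  obtain ⟨U, K, h⟩ := (hb.isAlternating hS h1).map phi hoff hs ht hl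
  obtain ⟨δ, hδ, hb', h1'⟩ := XDigraph.exists_isBridge_of_isAlternating h hS'
  have hlab : S'.lab δ.1 = S.lab ε.1 := congrArg Prod.fst hδ
  rw [← hlab]
  refine ⟨⟨δ.1, rfl, hb'.unique, fun he => hb'.not_eqvGen ?_⟩, hb'.propertyL hS'.2.1 h1'⟩
  rcases δ with ⟨e, _ | _⟩
  exacts [he.symm, he]
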